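/- arXiv:2502.01958 — 11 statements merged into one kernel-verified Lean document; each statement's English description precedes it below -/
import Mathlib

section
/- Let c be a proper coloring of the plane with 6 colors, let A and B be nonempty open connected subsets of the plane on which c is constant with values a and b respectively, and let u, v be points with u, v ∈ closure A ∩ closure B. Then every point z with dist z u < 1 and dist z v > 1 satisfies c z ≠ a and c z ≠ b. -/
/-- If `u` and `v` both lie on the common boundary of two monochromatic regions of colors
`a` and `b`, then no point `z` with `dist z u < 1` and `dist z v > 1` can be colored `a` or `b`. -/
theorem stmt_1 (c : EuclideanSpace ℝ (Fin 2) → Fin 6)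
    (hc : ∀ x y : EuclideanSpace ℝ (Fin 2), dist x y = 1 → c x ≠ c y)
    (A B : Set (EuclideanSpace ℝ (Fin 2))) (a b : Fin 6)
    (hAopen : IsOpen A) (hAconn : IsConnected A) (hAa : ∀ x ∈ A, c x = a)
    (hBopen : IsOpen B) (hBconn : IsConnected B) (hBb : ∀ x ∈ B, c x = b)
    (u v : EuclideanSpace ℝ (Fin 2))
    (hu : u ∈ closure A ∩ closure B) (hv : v ∈ closure A ∩ closure B)
    (z : EuclideanSpace ℝ (Fin 2)) (hzu : dist z u < 1) (hzv : dist z v > 1) :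
    c z ≠ a ∧ c z ≠ b := by
  have key : ∀ (S : Set (EuclideanSpace ℝ (Fin 2))) (s : Fin 6), IsConnected S →
      (∀ x ∈ S, c x = s) → u ∈ closure S → v ∈ closure S → c z ≠ s := by
    intro S s hS hs huS hvS
    have hcont : Continuous (fun x : EuclideanSpace ℝ (Fin 2) => dist z x) := by fun_prop
    obtain ⟨p, hp1, hpS⟩ := mem_closure_iff.1 huS {x | dist z x < 1}
      (isOpen_lt hcont continuous_const) hzu
    obtain ⟨q, hq1, hqS⟩ := mem_closure_iff.1 hvS {x | 1 < dist z x}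
      (isOpen_lt continuous_const hcont) hzv
    obtain ⟨w, hwS, hw⟩ := hS.isPreconnected.intermediate_value hpS hqS hcont.continuousOn
      ⟨le_of_lt hp1, le_of_lt hq1⟩
    rw [← hs w hwS]
    exact hc z w hw
  exact ⟨key A a hAconn hAa hu.1 hv.1, key B b hBconn hBb hu.2 hv.2⟩
end

section
/- Let c be a proper coloring of the plane with 6 colors. If x lies in the interior of its own color class, i.e. x ∈ interior (c ⁻¹' {c x}), and dist x y = 1, then y ∉ closure (c ⁻¹' {c x}). -/
/-- If `x` is a monochromatic point (in the interior of its color class) and `dist x y = 1`,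
then the color of `x` does not appear in the multicolor of `y`. -/
theorem stmt_2 (c : EuclideanSpace ℝ (Fin 2) → Fin 6)
    (hc : ∀ x y : EuclideanSpace ℝ (Fin 2), dist x y = 1 → c x ≠ c y)
    (x y : EuclideanSpace ℝ (Fin 2))
    (hx : x ∈ interior (c ⁻¹' {c x})) (hxy : dist x y = 1) :
    y ∉ closure (c ⁻¹' {c x}) := by
  intro hy
  obtain ⟨ε, hε, hball⟩ := Metric.mem_nhds_iff.1 (mem_interior_iff_mem_nhds.1 hx)
  obtain ⟨z, hz, hyz⟩ := Metric.mem_closure_iff.1 hy ε hε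
  have h1 : x + (z - y) ∈ Metric.ball x ε := by
    rw [Metric.mem_ball, dist_eq_norm, add_sub_cancel_left, ← dist_eq_norm, dist_comm]
    exact hyz
  have h2 : dist (x + (z - y)) z = 1 := by
    rw [dist_eq_norm] at hxy ⊢
    rw [← hxy]
    congr 1
    abel
  have h3 : c (x + (z - y)) = c x := hball h1
  have h4 : c z = c x := hz
  exact hc _ _ h2 (h3.trans h4.symm)
end

section
/- Let c be a proper coloring of the plane with 6 colors, let a be a color, and let x, y, z, w be points with dist x y = 1, dist y z > 1 and dist y w < 1. Suppose there are continuous curves γ₁, γ₂ : [0,1] → ℝ² with γ₁ 0 = γ₂ 0 = x, γ₁ 1 = z, γ₂ 1 = w, and c (γ₁ t) = a and c (γ₂ t) = a for every t ∈ (0,1] (the point x itself may have a different color). Then y ∉ closure (interior (c ⁻¹' {a})). -/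
/-- If `x` is connected by continuous curves of color `a` (except possibly at `x` itself)
to a point `z` with `dist y z > 1` and to a point `w` with `dist y w < 1`, where `dist x y = 1`,
then color `a` does not appear in the multicolor of `y`. -/
theorem stmt_3 (c : EuclideanSpace ℝ (Fin 2) → Fin 6)
    (hc : ∀ x y : EuclideanSpace ℝ (Fin 2), dist x y = 1 → c x ≠ c y)
    (a : Fin 6) (x y z w : EuclideanSpace ℝ (Fin 2))
    (hxy : dist x y = 1) (hyz : dist y z > 1) (hyw : dist y w < 1)
    (γ₁ γ₂ : ℝ → EuclideanSpace ℝ (Fin 2))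
    (hγ₁ : ContinuousOn γ₁ (Set.Icc 0 1)) (hγ₂ : ContinuousOn γ₂ (Set.Icc 0 1))
    (hγ₁0 : γ₁ 0 = x) (hγ₂0 : γ₂ 0 = x) (hγ₁1 : γ₁ 1 = z) (hγ₂1 : γ₂ 1 = w)
    (hγ₁a : ∀ t ∈ Set.Ioc (0 : ℝ) 1, c (γ₁ t) = a)
    (hγ₂a : ∀ t ∈ Set.Ioc (0 : ℝ) 1, c (γ₂ t) = a) :
    y ∉ closure (interior (c ⁻¹' {a})) := by
  intro hy
  have hVo : IsOpen {p : EuclideanSpace ℝ (Fin 2) | 1 < dist p z ∧ dist p w < 1} :=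
    IsOpen.and (isOpen_lt continuous_const (continuous_id.dist continuous_const))
      (isOpen_lt (continuous_id.dist continuous_const) continuous_const)
  obtain ⟨p, hpV, hpU⟩ := mem_closure_iff.1 hy _ hVo ⟨hyz, hyw⟩
  -- a point of the open set off the unit circle around `x`
  have hq : ∃ q, (1 < dist q z ∧ dist q w < 1) ∧ c q = a ∧ dist q x ≠ 1 := by
    by_contra hcon
    push Not at hcon
    have hsub : {p : EuclideanSpace ℝ (Fin 2) | 1 < dist p z ∧ dist p w < 1} ∩
        interior (c ⁻¹' {a}) ⊆ Metric.sphere x 1 := by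
      rintro q ⟨hq1, hq2⟩
      have hq3 : q ∈ c ⁻¹' {a} := interior_subset hq2
      exact hcon q hq1 hq3
    have := interior_maximal hsub (hVo.inter isOpen_interior) ⟨hpV, hpU⟩
    rw [interior_sphere _ (one_ne_zero)] at this
    exact this
  obtain ⟨q, ⟨hqz, hqw⟩, hqa, hqx⟩ := hq
  rcases lt_or_gt_of_ne hqx with h | h
  · have hcont : ContinuousOn (fun t => dist q (γ₁ t)) (Set.Icc 0 1) :=
      (continuous_const.dist continuous_id).comp_continuousOn hγ₁
    obtain ⟨t, ht, hd⟩ := intermediate_value_Icc zero_le_one hcont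
      (show (1 : ℝ) ∈ Set.Icc _ _ from ⟨by simpa [hγ₁0] using h.le, by simpa [hγ₁1] using hqz.le⟩)
    have ht0 : t ≠ 0 := by
      rintro rfl
      exact hqx (by simpa [hγ₁0] using hd)
    exact hc _ _ hd (hqa.trans (hγ₁a t ⟨lt_of_le_of_ne ht.1 ht0.symm, ht.2⟩).symm)
  · have hcont : ContinuousOn (fun t => dist q (γ₂ t)) (Set.Icc 0 1) :=
      (continuous_const.dist continuous_id).comp_continuousOn hγ₂
    obtain ⟨t, ht, hd⟩ := intermediate_value_Icc' zero_le_one hcont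
      (show (1 : ℝ) ∈ Set.Icc _ _ from ⟨by simpa [hγ₂1] using hqw.le, by simpa [hγ₂0] using h.le⟩)
    have ht0 : t ≠ 0 := by
      rintro rfl
      exact hqx (by simpa [hγ₂0] using hd)
    exact hc _ _ hd (hqa.trans (hγ₂a t ⟨lt_of_le_of_ne ht.1 ht0.symm, ht.2⟩).symm)
end

section
/- Let c be a proper coloring of the plane with 6 colors and let a, b be distinct colors. There do not exist points x, y with dist x y = 1 such that: (i) there is ε > 0 with c p ∈ {a, b} for every p in the open ball of radius ε around x and for every p in the open ball of radius ε around y; and (ii) both x and y lie in closure (interior (c ⁻¹' {a})) ∩ closure (interior (c ⁻¹' {b})). (In the paper's language: there are no two bichromatic points with the same multicolor {a,b} at distance exactly 1.) -/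
/-- A nonzero vector of length at most 2 is a sum of two unit vectors. -/
theorem split_unit (w : EuclideanSpace ℝ (Fin 2)) (h0 : 0 < ‖w‖) (h2 : ‖w‖ ≤ 2) :
    ∃ u v : EuclideanSpace ℝ (Fin 2), ‖u‖ = 1 ∧ ‖v‖ = 1 ∧ u + v = w ∧
      ‖u - (1 / 2 : ℝ) • w‖ = √(1 - ‖w‖ ^ 2 / 4) ∧
      ‖v - (1 / 2 : ℝ) • w‖ = √(1 - ‖w‖ ^ 2 / 4) := by
  have hs : 0 ≤ 1 - ‖w‖ ^ 2 / 4 := by nlinarith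
  set s := √(1 - ‖w‖ ^ 2 / 4) with hsdef
  have hs2 : s ^ 2 = 1 - ‖w‖ ^ 2 / 4 := Real.sq_sqrt hs
  have hs0 : 0 ≤ s := Real.sqrt_nonneg _
  obtain ⟨k, hk⟩ : ∃ k : ℝ, k * ‖w‖ = s := ⟨s / ‖w‖, by field_simp⟩
  have hw : ‖w‖ ^ 2 = w 0 ^ 2 + w 1 ^ 2 := by
    simp [EuclideanSpace.norm_sq_eq, Fin.sum_univ_two]
  have hk2 : k ^ 2 * (w 0 ^ 2 + w 1 ^ 2) = 1 - (w 0 ^ 2 + w 1 ^ 2) / 4 := by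
    rw [← hw, ← hs2, ← hk]; ring
  set d : EuclideanSpace ℝ (Fin 2) := k • !₂[-w 1, w 0] with hd
  have hd0 : d 0 = k * (-w 1) := by simp [hd]
  have hd1 : d 1 = k * w 0 := by simp [hd]
  have hdn : ‖d‖ = s := by
    refine (sq_eq_sq₀ (norm_nonneg _) hs0).1 ?_
    rw [hs2, hw, EuclideanSpace.norm_sq_eq, Fin.sum_univ_two, Real.norm_eq_abs, Real.norm_eq_abs,
      sq_abs, sq_abs, hd0, hd1]
    linarith
  refine ⟨(1 / 2 : ℝ) • w + d, (1 / 2 : ℝ) • w - d, ?_, ?_, ?_, ?_, ?_⟩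
  · refine (sq_eq_sq₀ (norm_nonneg _) zero_le_one).1 ?_
    rw [EuclideanSpace.norm_sq_eq, Fin.sum_univ_two, Real.norm_eq_abs, Real.norm_eq_abs,
      sq_abs, sq_abs]
    simp only [PiLp.add_apply, PiLp.smul_apply, smul_eq_mul, hd0, hd1]
    linarith
  · refine (sq_eq_sq₀ (norm_nonneg _) zero_le_one).1 ?_
    rw [EuclideanSpace.norm_sq_eq, Fin.sum_univ_two, Real.norm_eq_abs, Real.norm_eq_abs,
      sq_abs, sq_abs]
    simp only [PiLp.sub_apply, PiLp.smul_apply, smul_eq_mul, hd0, hd1]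
    linarith
  · module
  · simpa using hdn
  · rw [sub_sub_cancel_left, norm_neg, hdn]

/-- Every sufficiently small vector is `u₁ - u₂ + u₃ - u₄` with unit vectors near `e`. -/
theorem small_rep (e : EuclideanSpace ℝ (Fin 2)) (he : ‖e‖ = 1) (η : ℝ) (hη : 0 < η) :
    ∃ δ > 0, ∀ v : EuclideanSpace ℝ (Fin 2), ‖v‖ < δ →
      ∃ u₁ u₂ u₃ u₄ : EuclideanSpace ℝ (Fin 2),
        ‖u₁‖ = 1 ∧ ‖u₂‖ = 1 ∧ ‖u₃‖ = 1 ∧ ‖u₄‖ = 1 ∧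
        ‖u₁ - e‖ < η ∧ ‖u₂ - e‖ < η ∧ ‖u₃ - e‖ < η ∧ ‖u₄ - e‖ < η ∧
        u₁ - u₂ + u₃ - u₄ = v := by
  have hcont : Continuous (fun w : EuclideanSpace ℝ (Fin 2) =>
      √(1 - ‖w‖ ^ 2 / 4) + ‖(1 / 2 : ℝ) • w - e‖) := by fun_prop
  have hz : √(1 - ‖(2 : ℝ) • e‖ ^ 2 / 4) + ‖(1 / 2 : ℝ) • ((2 : ℝ) • e) - e‖ = 0 := by
    rw [norm_smul, he, smul_smul]
    norm_num
  obtain ⟨δ, hδ, H⟩ := Metric.continuous_iff.1 hcont ((2 : ℝ) • e) η hη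
  -- unit decompositions near twice e
  have key : ∀ w : EuclideanSpace ℝ (Fin 2), ‖w - (2 : ℝ) • e‖ < δ → 0 < ‖w‖ → ‖w‖ ≤ 2 →
      ∃ u v : EuclideanSpace ℝ (Fin 2), ‖u‖ = 1 ∧ ‖v‖ = 1 ∧ u + v = w ∧
        ‖u - e‖ < η ∧ ‖v - e‖ < η := by
    intro w hw h0 h2
    obtain ⟨u, v, hu, hv, huv, h3, h4⟩ := split_unit w h0 h2
    have h5 := H w (by rwa [dist_eq_norm])
    rw [hz, Real.dist_eq, sub_zero] at h5
    have h6 := lt_of_abs_lt h5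
    refine ⟨u, v, hu, hv, huv, ?_, ?_⟩
    · have := norm_sub_le_norm_sub_add_norm_sub u ((1 / 2 : ℝ) • w) e
      linarith
    · have := norm_sub_le_norm_sub_add_norm_sub v ((1 / 2 : ℝ) • w) e
      linarith
  set t := min (δ / 2) 1 with ht
  have ht0 : 0 < t := by positivity
  have ht1 : t ≤ 1 := min_le_right _ _
  have htd : t ≤ δ / 2 := min_le_left _ _
  have hn0 : ‖(2 - t) • e‖ = 2 - t := by
    rw [norm_smul, he, Real.norm_eq_abs, abs_of_pos (by linarith), mul_one]
  have hn1 : ‖(2 - t) • e - (2 : ℝ) • e‖ = t := by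
    rw [← sub_smul, norm_smul, he, mul_one, Real.norm_eq_abs, abs_of_neg (by linarith)]
    ring
  refine ⟨t / 2, by positivity, fun v hv => ?_⟩
  obtain ⟨u₂, u₄, h2, h4, h24, h2e, h4e⟩ := key ((2 - t) • e) (by linarith) (by linarith)
    (by linarith)
  obtain ⟨u₁, u₃, h1, h3, h13, h1e, h3e⟩ := key ((2 - t) • e + v)
    (by
      have := norm_add_le ((2 - t) • e - (2 : ℝ) • e) v
      rw [add_sub_right_comm]
      linarith)
    (by
      have := norm_sub_le ((2 - t) • e + v) v
      rw [add_sub_cancel_right] at this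
      linarith)
    (by
      have := norm_add_le ((2 - t) • e) v
      linarith)
  refine ⟨u₁, u₂, u₃, u₄, h1, h2, h3, h4, h1e, h2e, h3e, h4e, ?_⟩
  have : u₁ - u₂ + u₃ - u₄ = (u₁ + u₃) - (u₂ + u₄) := by abel
  rw [this, h13, h24]
  abel

/-- There do not exist two bichromatic points with the same multicolor `{a, b}` at distance
exactly 1. -/
theorem stmt_4 (c : EuclideanSpace ℝ (Fin 2) → Fin 6)
    (hc : ∀ x y : EuclideanSpace ℝ (Fin 2), dist x y = 1 → c x ≠ c y)
    (a b : Fin 6) (hab : a ≠ b) :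
    ¬ ∃ x y : EuclideanSpace ℝ (Fin 2), dist x y = 1 ∧
      (∃ ε > (0 : ℝ),
        (∀ p ∈ Metric.ball x ε, c p ∈ ({a, b} : Set (Fin 6))) ∧
        (∀ p ∈ Metric.ball y ε, c p ∈ ({a, b} : Set (Fin 6)))) ∧
      x ∈ closure (interior (c ⁻¹' {a})) ∩ closure (interior (c ⁻¹' {b})) ∧
      y ∈ closure (interior (c ⁻¹' {a})) ∩ closure (interior (c ⁻¹' {b})) := by
  rintro ⟨x, y, hxy, ⟨ε, hε, hx, hy⟩, ⟨hxa, hxb⟩, -⟩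
  have he : ‖y - x‖ = 1 := by rw [← dist_eq_norm, dist_comm]; exact hxy
  obtain ⟨δ, hδ, H⟩ := small_rep (y - x) he (ε / 4) (by positivity)
  -- two points near `x` with a common unit neighbour near `y` have the same color
  have step : ∀ p u uu : EuclideanSpace ℝ (Fin 2), ‖p - x‖ < ε / 2 → ‖u‖ = 1 → ‖uu‖ = 1 →
      ‖u - (y - x)‖ < ε / 4 → ‖uu - (y - x)‖ < ε / 4 → c (p + u - uu) = c p := by
    intro p u uu hp hu huu h h'
    have hq : c (p + u) ∈ ({a, b} : Set (Fin 6)) := by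
      apply hy
      rw [Metric.mem_ball, dist_eq_norm]
      have e1 : p + u - y = (p - x) + (u - (y - x)) := by abel
      have := norm_add_le (p - x) (u - (y - x))
      rw [e1]; linarith
    have hpc : c p ∈ ({a, b} : Set (Fin 6)) := by
      apply hx
      rw [Metric.mem_ball, dist_eq_norm]; linarith
    have hp' : c (p + u - uu) ∈ ({a, b} : Set (Fin 6)) := by
      apply hx
      rw [Metric.mem_ball, dist_eq_norm]
      have e1 : p + u - uu - x = (p - x) + ((u - (y - x)) - (uu - (y - x))) := by abel
      have h1 := norm_add_le (p - x) ((u - (y - x)) - (uu - (y - x)))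
      have h2 := norm_sub_le (u - (y - x)) (uu - (y - x))
      rw [e1]; linarith
    have n1 : c (p + u) ≠ c p := hc _ _ (by rw [dist_eq_norm, add_sub_cancel_left, hu])
    have n2 : c (p + u) ≠ c (p + u - uu) := hc _ _ (by rw [dist_eq_norm, sub_sub_cancel, huu])
    simp only [Set.mem_insert_iff, Set.mem_singleton_iff] at hq hpc hp'
    rcases hpc with k1 | k1 <;> rcases hp' with k2 | k2
    · rw [k1, k2]
    · exfalso
      rw [k1] at n1
      rw [k2] at n2
      exact hq.elim n1 n2
    · exfalso
      rw [k1] at n1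
      rw [k2] at n2
      exact hq.elim n2 n1
    · rw [k1, k2]
  have const : ∀ z, dist x z < δ → c z = c x := by
    intro z hz
    obtain ⟨u₁, u₂, u₃, u₄, h1, h2, h3, h4, h1e, h2e, h3e, h4e, hs⟩ := H (z - x) (by
      rw [← dist_eq_norm, dist_comm]; exact hz)
    have s1 := step x u₁ u₂ (by rw [sub_self, norm_zero]; positivity) h1 h2 h1e h2e
    have s2 := step (x + u₁ - u₂) u₃ u₄ (by
      have e1 : x + u₁ - u₂ - x = (u₁ - (y - x)) - (u₂ - (y - x)) := by abel
      have := norm_sub_le (u₁ - (y - x)) (u₂ - (y - x))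
      rw [e1]; linarith) h3 h4 h3e h4e
    have e2 : x + u₁ - u₂ + u₃ - u₄ = z := by
      have : x + u₁ - u₂ + u₃ - u₄ = x + (u₁ - u₂ + u₃ - u₄) := by abel
      rw [this, hs]; abel
    rw [← e2, s2, s1]
  obtain ⟨z, hz, hzd⟩ := Metric.mem_closure_iff.1 hxa δ hδ
  obtain ⟨z', hz', hzd'⟩ := Metric.mem_closure_iff.1 hxb δ hδ
  have ha : c z = a := by simpa using interior_subset hz
  have hb : c z' = b := by simpa using interior_subset hz'
  exact hab (by rw [← ha, ← hb, const z hzd, const z' hzd'])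
end

section
/- Let c be a proper coloring of the plane with 6 colors satisfying the forbidden-arcs condition. Let u be a point, and let x, y lie on the unit circle ω = Metric.sphere u 1 with dist x y = 1. Suppose there exist ε > 0 and colors a₁, a₂, b₁, b₂ with {a₁, a₂} = {b₁, b₂} = {a, b} for two distinct colors a ≠ b, such that: for every p ∈ ω with 0 < dist p x < ε, c p = a₁ if dist p y < 1 and c p = a₂ if dist p y > 1; and for every p ∈ ω with 0 < dist p y < ε, c p = b₁ if dist p x < 1 and c p = b₂ if dist p x > 1. Then for every δ > 0 there exist points p₁, p₂, q₁, q₂ with: dist p₁ x < δ, dist p₁ u < 1, c p₁ ∉ {a, b}; dist p₂ x < δ, dist p₂ u > 1, c p₂ ∉ {a, b}; dist q₁ y < δ, dist q₁ u < 1, c q₁ ∉ {a, b}; and dist q₂ y < δ, dist q₂ u > 1, c q₂ ∉ {a, b}. -/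
open Filter Topology in
/-- Near a point, a finite set contains at most the point itself. -/
lemma aux_finite {X : Type*} [TopologicalSpace X] [T1Space X] {F : Set X} (hF : F.Finite) (x : X) :
    ∀ᶠ p in 𝓝 x, p ∈ F → p = x := by
  have h : IsClosed (F \ {x}) := (hF.subset Set.sdiff_subset).isClosed
  have h2 : (F \ {x})ᶜ ∈ 𝓝 x := h.isOpen_compl.mem_nhds (by simp)
  filter_upwards [h2] with p hp hpF
  by_contra hne
  exact hp ⟨hpF, hne⟩

/-- A limit of points of color `i` is not at distance 1 from an interior point of color `i`. -/
lemma aux_closure {E : Type*} [NormedAddCommGroup E] (c : E → Fin 6)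
    (hc : ∀ x y : E, dist x y = 1 → c x ≠ c y) (i : Fin 6) (z w : E)
    (hz : z ∈ closure (c ⁻¹' {i})) (hw : w ∈ interior (c ⁻¹' {i})) (h : dist w z = 1) : False := by
  rw [mem_interior_iff_mem_nhds, Metric.mem_nhds_iff] at hw
  obtain ⟨r, hr, hball⟩ := hw
  rw [Metric.mem_closure_iff] at hz
  obtain ⟨z', hz', hd⟩ := hz r hr
  have h1 : w + (z' - z) ∈ c ⁻¹' {i} := by
    apply hball
    rw [Metric.mem_ball, dist_eq_norm]
    rw [dist_comm, dist_eq_norm] at hd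
    simpa using hd
  refine hc (w + (z' - z)) z' ?_ ?_
  · rw [dist_eq_norm] at h ⊢
    rw [← h]; congr 1; abel
  · simp only [Set.mem_preimage, Set.mem_singleton_iff] at h1 hz'
    rw [h1, hz']

lemma aux_interior {E : Type*} [TopologicalSpace E] (c : E → Fin 6) (w : E)
    (h : w ∉ ⋃ i : Fin 6, frontier (c ⁻¹' {i})) : w ∈ interior (c ⁻¹' {c w}) := by
  by_contra hn
  exact h (Set.mem_iUnion.2 ⟨c w, subset_closure (by simp), hn⟩)

/-- Polar coordinates around `u` adapted to `x` and `y`. -/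
lemma aux_polar {E : Type*} [NormedAddCommGroup E] [InnerProductSpace ℝ E] (u x y : E)
    (hx : dist x u = 1) (hy : dist y u = 1) (hxy : dist x y = 1) :
    ∃ P : ℝ × ℝ → E, Continuous P ∧ P (1, 0) = x ∧ P (1, Real.pi / 3) = y ∧
      (∀ r t, dist (P (r, t)) u = |r|) ∧
      (∀ s t, dist (P (1, s)) (P (1, t)) ^ 2 = 2 - 2 * Real.cos (s - t)) := by
  set e := x - u with he
  set v := y - u with hv
  have s3 : Real.sqrt 3 ^ 2 = 3 := Real.sq_sqrt (by norm_num)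
  have s3' : Real.sqrt 3 ≠ 0 := by positivity
  have hee : inner ℝ e e = 1 := by
    rw [real_inner_self_eq_norm_sq, he, ← dist_eq_norm, hx]; norm_num
  have hvv : inner ℝ v v = 1 := by
    rw [real_inner_self_eq_norm_sq, hv, ← dist_eq_norm, hy]; norm_num
  have hev : inner ℝ e v = 1 / 2 := by
    have h1 : ‖e - v‖ = 1 := by rw [← hxy, dist_eq_norm, he, hv]; congr 1; abel
    have h2 := norm_sub_sq_real e v
    rw [← real_inner_self_eq_norm_sq e, ← real_inner_self_eq_norm_sq v, hee, hvv, h1] at h2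
    linarith
  have hve : inner ℝ v e = 1 / 2 := by rw [real_inner_comm]; exact hev
  set f := (2 / Real.sqrt 3) • (v - (1 / 2 : ℝ) • e) with hf
  have hef : inner ℝ e f = 0 := by
    simp only [hf, inner_sub_right, inner_smul_right, hev, hee]; ring
  have hff : inner ℝ f f = 1 := by
    simp only [hf, inner_sub_right, inner_smul_right, inner_sub_left, real_inner_smul_left, hev,
      hve, hee, hvv]
    field_simp
    rw [s3]; norm_num
  have hn : ∀ α β : ℝ, ‖α • e + β • f‖ ^ 2 = α ^ 2 + β ^ 2 := by
    intro α β
    rw [← real_inner_self_eq_norm_sq]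
    have hfe : inner ℝ f e = 0 := by rw [real_inner_comm]; exact hef
    simp only [inner_add_left, inner_add_right, inner_smul_right, real_inner_smul_left, hee, hff,
      hef, hfe]
    ring
  refine ⟨fun q => u + ((q.1 * Real.cos q.2) • e + (q.1 * Real.sin q.2) • f), by fun_prop,
    by simp [he], ?_, ?_, ?_⟩
  · have : (Real.sqrt 3 / 2) • f = v - (1 / 2 : ℝ) • e := by
      rw [hf, smul_smul]
      have : Real.sqrt 3 / 2 * (2 / Real.sqrt 3) = 1 := by field_simp
      rw [this, one_smul]
    simp only [one_mul, Real.cos_pi_div_three, Real.sin_pi_div_three, this]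
    rw [hv]; abel
  · intro r t
    rw [dist_eq_norm, add_sub_cancel_left, ← abs_norm, ← sq_eq_sq_iff_abs_eq_abs, hn]
    linear_combination r ^ 2 * Real.sin_sq_add_cos_sq t
  · intro s t
    have : u + ((1 * Real.cos s) • e + (1 * Real.sin s) • f)
        - (u + ((1 * Real.cos t) • e + (1 * Real.sin t) • f))
        = (Real.cos s - Real.cos t) • e + (Real.sin s - Real.sin t) • f := by
      module
    rw [dist_eq_norm]
    simp only
    rw [this, hn, Real.cos_sub]
    linear_combination Real.sin_sq_add_cos_sq s + Real.sin_sq_add_cos_sq t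

open Filter Topology in
lemma aux_main {E : Type*} [NormedAddCommGroup E] [InnerProductSpace ℝ E] (c : E → Fin 6)
    (hc : ∀ x y : E, dist x y = 1 → c x ≠ c y)
    (hfa : ∀ v : E,
      (Metric.sphere v 1 ∩ ⋃ i : Fin 6, frontier (c ⁻¹' {i})).Finite)
    (u x y : E)
    (hx : x ∈ Metric.sphere u 1) (hy : y ∈ Metric.sphere u 1) (hxy : dist x y = 1)
    (a b : Fin 6) (hab : a ≠ b)
    (ε : ℝ) (hε : 0 < ε) (a₁ a₂ b₁ b₂ : Fin 6)
    (ha : ({a₁, a₂} : Set (Fin 6)) = {a, b}) (hb : ({b₁, b₂} : Set (Fin 6)) = {a, b})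
    (hx₁ : ∀ p ∈ Metric.sphere u 1, 0 < dist p x → dist p x < ε → dist p y < 1 → c p = a₁)
    (hx₂ : ∀ p ∈ Metric.sphere u 1, 0 < dist p x → dist p x < ε → 1 < dist p y → c p = a₂)
    (hy₁ : ∀ p ∈ Metric.sphere u 1, 0 < dist p y → dist p y < ε → dist p x < 1 → c p = b₁)
    (hy₂ : ∀ p ∈ Metric.sphere u 1, 0 < dist p y → dist p y < ε → 1 < dist p x → c p = b₂)
    (δ : ℝ) (hδ : 0 < δ) :
    ∀ᶠ r in 𝓝 (1 : ℝ), r ≠ 1 → ∃ p, dist p u = |r| ∧ dist p x < δ ∧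
      c p ∉ ({a, b} : Set (Fin 6)) := by
  obtain ⟨P, hPc, hP0, hP1, hPu, hPd⟩ := aux_polar u x y hx hy hxy
  have hpi := Real.pi_pos
  have ha12 : a₁ ≠ a₂ := by
    rintro rfl
    have h1 : a ∈ ({a₁, a₁} : Set (Fin 6)) := by rw [ha]; simp
    have h2 : b ∈ ({a₁, a₁} : Set (Fin 6)) := by rw [ha]; simp
    simp at h1 h2
    exact hab (h1.trans h2.symm)
  have hS : ∀ t, P (1, t) ∈ Metric.sphere u 1 := by
    intro t; rw [Metric.mem_sphere, hPu]; simp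
  have hlt : ∀ s t, 1 / 2 < Real.cos (s - t) → dist (P (1, s)) (P (1, t)) < 1 := by
    intro s t h
    have := hPd s t
    have h0 := dist_nonneg (x := P (1, s)) (y := P (1, t))
    nlinarith
  have hgt : ∀ s t, Real.cos (s - t) < 1 / 2 → 1 < dist (P (1, s)) (P (1, t)) := by
    intro s t h
    have := hPd s t
    have h0 := dist_nonneg (x := P (1, s)) (y := P (1, t))
    nlinarith
  have hpos : ∀ s t, s ≠ t → |s - t| < Real.pi → 0 < dist (P (1, s)) (P (1, t)) := by
    intro s t hst h
    have h1 := hPd s t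
    have h2 : Real.cos (s - t) < 1 := by
      rw [← Real.cos_abs, ← Real.cos_zero]
      exact Real.cos_lt_cos_of_nonneg_of_le_pi le_rfl h.le (abs_pos.2 (sub_ne_zero.2 hst))
    have h0 := dist_nonneg (x := P (1, s)) (y := P (1, t))
    rcases h0.eq_or_lt with h | h
    · rw [← h] at h1; nlinarith
    · exact h
  have hcosgt : ∀ t, 0 ≤ t → t < Real.pi / 3 → 1 / 2 < Real.cos t := by
    intro t h0 h1
    rw [← Real.cos_pi_div_three]
    exact Real.cos_lt_cos_of_nonneg_of_le_pi h0 (by linarith) h1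
  have hcoslt : ∀ t, Real.pi / 3 < t → t ≤ Real.pi → Real.cos t < 1 / 2 := by
    intro t h0 h1
    rw [← Real.cos_pi_div_three]
    exact Real.cos_lt_cos_of_nonneg_of_le_pi (by linarith) h1 h0
  -- choice of the arc around `y`
  have hEy : ∀ᶠ p in 𝓝 y, dist p y < ε ∧
      (p ∈ Metric.sphere u 1 ∩ ⋃ i : Fin 6, frontier (c ⁻¹' {i}) → p = y) :=
    Eventually.and (Metric.ball_mem_nhds y hε) (aux_finite (hfa u) y)
  have hTy : Tendsto (fun t : ℝ => P (1, Real.pi / 3 + t)) (𝓝 0) (𝓝 y) := by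
    have : Continuous (fun t : ℝ => P (1, Real.pi / 3 + t)) := by fun_prop
    have h := this.tendsto 0
    simpa [hP1] using h
  obtain ⟨τ', hτ', hEy'⟩ := Metric.eventually_nhds_iff.1 (hTy.eventually hEy)
  obtain ⟨τ, hτ, hτ1, hτ2⟩ : ∃ τ, 0 < τ ∧ τ < τ' ∧ τ < Real.pi / 3 := by
    refine ⟨min τ' (Real.pi / 3) / 2, ?_, ?_, ?_⟩
    · positivity
    · have := min_le_left τ' (Real.pi / 3); linarith
    · have := min_le_right τ' (Real.pi / 3); linarith
  have hym : dist (P (1, Real.pi / 3 + -τ)) x < 1 := by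
    rw [← hP0]; apply hlt; apply hcosgt <;> linarith
  have hyp : 1 < dist (P (1, Real.pi / 3 + τ)) x := by
    rw [← hP0]; apply hgt; apply hcoslt <;> linarith
  -- interior points on the arc around `y`
  have harcy : ∀ t, t ≠ 0 → -τ ≤ t → t ≤ τ → c (P (1, Real.pi / 3 + t)) ∈ ({a, b} : Set (Fin 6)) ∧
      P (1, Real.pi / 3 + t) ∈ interior (c ⁻¹' {c (P (1, Real.pi / 3 + t))}) := by
    intro t ht h1 h2
    obtain ⟨h3, h4⟩ := hEy' (y := t)
      (by rw [Real.dist_eq, sub_zero]; exact (abs_le.2 ⟨h1, h2⟩).trans_lt hτ1)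
    have h5 : 0 < dist (P (1, Real.pi / 3 + t)) y := by
      rw [← hP1]
      apply hpos
      · simpa using ht
      · rw [add_sub_cancel_left]; exact (abs_le.2 ⟨h1, h2⟩).trans_lt (by linarith)
    constructor
    · rw [← hb]
      rcases lt_or_gt_of_ne ht with h | h
      · left
        refine hy₁ _ (hS _) h5 h3 ?_
        rw [← hP0]; apply hlt; apply hcosgt <;> linarith
      · right
        refine hy₂ _ (hS _) h5 h3 ?_
        rw [← hP0]; apply hgt; apply hcoslt <;> linarith
    · apply aux_interior
      intro hF
      have := h4 ⟨hS _, hF⟩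
      rw [this, dist_self] at h5
      exact lt_irrefl _ h5
  -- good neighborhood of `x`
  have hEx : ∀ᶠ p in 𝓝 x, dist p x < δ ∧ dist p x < ε ∧
      (p ∈ Metric.sphere u 1 ∩ ⋃ i : Fin 6, frontier (c ⁻¹' {i}) → p = x) ∧
      (p ∈ Metric.sphere y 1 ∩ ⋃ i : Fin 6, frontier (c ⁻¹' {i}) → p = x) ∧
      dist (P (1, Real.pi / 3 + -τ)) p < 1 ∧ 1 < dist (P (1, Real.pi / 3 + τ)) p := by
    refine Eventually.and (Metric.ball_mem_nhds x hδ) (Eventually.and (Metric.ball_mem_nhds x hε)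
      ((aux_finite (hfa u) x).and ((aux_finite (hfa y) x).and (Eventually.and ?_ ?_))))
    · have h : Continuous (fun p => dist (P (1, Real.pi / 3 + -τ)) p) := by fun_prop
      exact h.continuousAt.eventually_lt continuousAt_const hym
    · have h : Continuous (fun p => dist (P (1, Real.pi / 3 + τ)) p) := by fun_prop
      exact continuousAt_const.eventually_lt h.continuousAt hyp
  have hTx : Tendsto P (𝓝 (1, 0)) (𝓝 x) := by
    have h := hPc.tendsto (1, 0)
    rwa [hP0] at h
  obtain ⟨η, hη, hEx'⟩ := Metric.eventually_nhds_iff.1 (hTx.eventually hEx)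
  have hbox : ∀ r t, |r - 1| < η → |t| < η → _ := fun r t hr ht => hEx' (y := (r, t)) (by
    rw [Prod.dist_eq, Real.dist_eq, Real.dist_eq, sub_zero]; exact max_lt hr ht)
  obtain ⟨θ, hθ, hθ1, hθ2⟩ : ∃ θ, 0 < θ ∧ θ < η ∧ θ < Real.pi / 3 := by
    refine ⟨min η (Real.pi / 3) / 2, ?_, ?_, ?_⟩
    · positivity
    · have := min_le_left η (Real.pi / 3); linarith
    · have := min_le_right η (Real.pi / 3); linarith
  -- the endpoints
  have hend : ∀ t, t ≠ 0 → |t| < η → |t| < Real.pi / 3 →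
      0 < dist (P (1, t)) x ∧ dist (P (1, t)) x < ε ∧
      ∀ᶠ r in 𝓝 (1 : ℝ), c (P (r, t)) = c (P (1, t)) := by
    intro t ht h1 h2
    obtain ⟨-, h3, h4, -⟩ := hbox 1 t (by simpa using hη) h1
    have h5 : 0 < dist (P (1, t)) x := by
      rw [← hP0]
      apply hpos _ _ ht
      rw [sub_zero]; linarith
    refine ⟨h5, h3, ?_⟩
    have h6 : P (1, t) ∈ interior (c ⁻¹' {c (P (1, t))}) := by
      apply aux_interior
      intro hF
      have := h4 ⟨hS _, hF⟩
      rw [this, dist_self] at h5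
      exact lt_irrefl _ h5
    have h7 : Continuous (fun r : ℝ => P (r, t)) := by fun_prop
    exact (h7.tendsto 1).eventually (mem_interior_iff_mem_nhds.1 h6)
  obtain ⟨h1, h2, hAe⟩ := hend θ hθ.ne' (by rwa [abs_of_pos hθ]) (by rwa [abs_of_pos hθ])
  obtain ⟨h3, h4, hBe⟩ := hend (-θ) (by linarith) (by rwa [abs_neg, abs_of_pos hθ])
    (by rwa [abs_neg, abs_of_pos hθ])
  have hA : c (P (1, θ)) = a₁ := by
    refine hx₁ _ (hS _) h1 h2 ?_
    rw [← hP1]; apply hlt; rw [← Real.cos_neg]; apply hcosgt <;> linarith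
  have hB : c (P (1, -θ)) = a₂ := by
    refine hx₂ _ (hS _) h3 h4 ?_
    rw [← hP1]; apply hgt; rw [← Real.cos_neg]; apply hcoslt <;> linarith
  filter_upwards [hAe, hBe, Metric.ball_mem_nhds (1 : ℝ) hη, lt_mem_nhds (zero_lt_one' ℝ)]
    with r hrA hrB hr hr0 hr1
  rw [hA] at hrA
  rw [hB] at hrB
  rw [Metric.mem_ball, Real.dist_eq] at hr
  by_contra hcon
  push Not at hcon
  have hcol : ∀ t ∈ Set.Icc (-θ) θ, c (P (r, t)) ∈ ({a₁, a₂} : Set (Fin 6)) := by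
    intro t ht
    rw [ha]
    exact hcon _ (hPu r t) (hbox r t hr ((abs_le.2 ht).trans_lt hθ1)).1
  have hPr : Continuous (fun t : ℝ => P (r, t)) := by fun_prop
  obtain ⟨t, ht, htA, htB⟩ := isPreconnected_closed_iff.1 (isPreconnected_Icc (a := -θ) (b := θ))
    ((fun t : ℝ => P (r, t)) ⁻¹' closure (c ⁻¹' {a₁}))
    ((fun t : ℝ => P (r, t)) ⁻¹' closure (c ⁻¹' {a₂}))
    (isClosed_closure.preimage hPr) (isClosed_closure.preimage hPr)
    (by
      intro t ht
      rcases hcol t ht with h | h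
      · exact Or.inl (subset_closure h)
      · exact Or.inr (subset_closure h))
    ⟨θ, ⟨by linarith, le_rfl⟩, subset_closure hrA⟩
    ⟨-θ, ⟨le_rfl, by linarith⟩, subset_closure hrB⟩
  simp only [Set.mem_preimage] at htA htB
  obtain ⟨-, -, -, hg, hm, hp⟩ := hbox r t hr ((abs_le.2 ht).trans_lt hθ1)
  have hzx : P (r, t) ≠ x := by
    intro h
    have h1 := hPu r t
    rw [h, Metric.mem_sphere.1 hx, abs_of_pos hr0] at h1
    exact hr1 h1.symm
  have hfr : P (r, t) ∈ ⋃ i : Fin 6, frontier (c ⁻¹' {i}) := by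
    refine Set.mem_iUnion.2 ⟨a₁, htA, ?_⟩
    rw [← Set.mem_compl_iff, ← closure_compl]
    refine closure_mono ?_ htB
    intro q hq hq'
    simp only [Set.mem_preimage, Set.mem_singleton_iff] at hq hq'
    exact ha12 (hq'.symm.trans hq)
  have hzy : dist y (P (r, t)) ≠ 1 := by
    intro h
    exact hzx (hg ⟨by rw [Metric.mem_sphere, dist_comm]; exact h, hfr⟩)
  have hcont : Continuous (fun s : ℝ => dist (P (1, Real.pi / 3 + s)) (P (r, t))) := by fun_prop
  obtain ⟨s, hs, hs1⟩ := intermediate_value_Icc (by linarith : -τ ≤ τ) hcont.continuousOn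
    (Set.mem_Icc.2 ⟨hm.le, hp.le⟩)
  simp only at hs1
  by_cases hs0 : s = 0
  · rw [hs0, add_zero, hP1] at hs1
    exact hzy hs1
  · obtain ⟨h5, h6⟩ := harcy s hs0 hs.1 hs.2
    rw [← ha] at h5
    rcases h5 with h5 | h5
    · rw [h5] at h6
      exact aux_closure c hc _ _ _ htA h6 hs1
    · rw [Set.mem_singleton_iff.1 h5] at h6
      exact aux_closure c hc _ _ _ htB h6 hs1



/-- If `x` and `y` lie on the unit circle `ω` around `u` at distance 1 from each other, and at
each of them one half-neighborhood along `ω` is colored `a` and the other `b`, then both inside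
and outside `ω`, arbitrarily close to `x` and to `y`, there are points of colors other than
`a` and `b`. -/
theorem stmt_5 (c : EuclideanSpace ℝ (Fin 2) → Fin 6)
    (hc : ∀ x y : EuclideanSpace ℝ (Fin 2), dist x y = 1 → c x ≠ c y)
    (hfa : ∀ v : EuclideanSpace ℝ (Fin 2),
      (Metric.sphere v 1 ∩ ⋃ i : Fin 6, frontier (c ⁻¹' {i})).Finite)
    (u x y : EuclideanSpace ℝ (Fin 2))
    (hx : x ∈ Metric.sphere u 1) (hy : y ∈ Metric.sphere u 1) (hxy : dist x y = 1)
    (a b : Fin 6) (hab : a ≠ b)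
    (ε : ℝ) (hε : 0 < ε) (a₁ a₂ b₁ b₂ : Fin 6)
    (ha : ({a₁, a₂} : Set (Fin 6)) = {a, b}) (hb : ({b₁, b₂} : Set (Fin 6)) = {a, b})
    (hx₁ : ∀ p ∈ Metric.sphere u 1, 0 < dist p x → dist p x < ε → dist p y < 1 → c p = a₁)
    (hx₂ : ∀ p ∈ Metric.sphere u 1, 0 < dist p x → dist p x < ε → 1 < dist p y → c p = a₂)
    (hy₁ : ∀ p ∈ Metric.sphere u 1, 0 < dist p y → dist p y < ε → dist p x < 1 → c p = b₁)
    (hy₂ : ∀ p ∈ Metric.sphere u 1, 0 < dist p y → dist p y < ε → 1 < dist p x → c p = b₂) :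
    ∀ δ > (0 : ℝ), ∃ p₁ p₂ q₁ q₂ : EuclideanSpace ℝ (Fin 2),
      dist p₁ x < δ ∧ dist p₁ u < 1 ∧ c p₁ ∉ ({a, b} : Set (Fin 6)) ∧
      dist p₂ x < δ ∧ 1 < dist p₂ u ∧ c p₂ ∉ ({a, b} : Set (Fin 6)) ∧
      dist q₁ y < δ ∧ dist q₁ u < 1 ∧ c q₁ ∉ ({a, b} : Set (Fin 6)) ∧
      dist q₂ y < δ ∧ 1 < dist q₂ u ∧ c q₂ ∉ ({a, b} : Set (Fin 6)) := by
  intro δ hδ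
  have key : ∀ x y : EuclideanSpace ℝ (Fin 2), ∀ _ : (∀ᶠ r in nhds (1 : ℝ), r ≠ 1 →
      ∃ p, dist p u = |r| ∧ dist p x < δ ∧ c p ∉ ({a, b} : Set (Fin 6))),
      ∃ p₁ p₂, dist p₁ x < δ ∧ dist p₁ u < 1 ∧ c p₁ ∉ ({a, b} : Set (Fin 6)) ∧
      dist p₂ x < δ ∧ 1 < dist p₂ u ∧ c p₂ ∉ ({a, b} : Set (Fin 6)) := by
    intro x _ h
    obtain ⟨η, hη, h'⟩ := Metric.eventually_nhds_iff.1 h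
    have hm : 0 < min η 1 / 2 := by positivity
    have hm1 := min_le_left η 1
    have hm2 := min_le_right η 1
    obtain ⟨p₁, h1, h2, h3⟩ := h' (y := 1 - min η 1 / 2)
      (by rw [Real.dist_eq, abs_lt]; constructor <;> linarith) (by linarith)
    obtain ⟨p₂, h4, h5, h6⟩ := h' (y := 1 + min η 1 / 2)
      (by rw [Real.dist_eq, abs_lt]; constructor <;> linarith) (by linarith)
    rw [abs_of_pos (by linarith)] at h1 h4
    exact ⟨p₁, p₂, h2, by linarith, h3, h5, by linarith, h6⟩
  obtain ⟨p₁, p₂, h1, h2, h3, h4, h5, h6⟩ := key x y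
    (aux_main c hc hfa u x y hx hy hxy a b hab ε hε a₁ a₂ b₁ b₂ ha hb hx₁ hx₂ hy₁ hy₂ δ hδ)
  obtain ⟨q₁, q₂, k1, k2, k3, k4, k5, k6⟩ := key y x
    (aux_main c hc hfa u y x hy hx (by rw [dist_comm]; exact hxy) a b hab ε hε b₁ b₂ a₁ a₂ hb ha
      hy₁ hy₂ hx₁ hx₂ δ hδ)
  exact ⟨p₁, p₂, q₁, q₂, h1, h2, h3, h4, h5, h6, k1, k2, k3, k4, k5, k6⟩
end

section
/- Let c be a proper coloring of the plane with 6 colors satisfying the forbidden-arcs condition. Then no point has chromaticity greater than 4: for every point x, the set {i : Fin 6 | x ∈ closure (interior (c ⁻¹' {i}))} has at most 4 elements. -/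
/-- A point of the unit circle around `x`. -/
noncomputable def circPt (x : EuclideanSpace ℝ (Fin 2)) (t : ℝ) : EuclideanSpace ℝ (Fin 2) :=
  x + !₂[Real.cos t, Real.sin t]

lemma circPt_dist (x : EuclideanSpace ℝ (Fin 2)) (t : ℝ) : dist (circPt x t) x = 1 := by
  simp [circPt, EuclideanSpace.norm_eq, Fin.sum_univ_two]

lemma circPt_dist_two (x : EuclideanSpace ℝ (Fin 2)) (t : ℝ) :
    dist (circPt x t) (circPt x (t + Real.pi / 3)) = 1 := by
  have h3 : (Real.sqrt 3) ^ 2 = 3 := Real.sq_sqrt (by norm_num)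
  have h := Real.sin_sq_add_cos_sq t
  rw [EuclideanSpace.dist_eq, Real.sqrt_eq_one, Fin.sum_univ_two, Real.dist_eq, Real.dist_eq,
    sq_abs, sq_abs]
  simp only [circPt, PiLp.add_apply, Matrix.cons_val_zero, Matrix.cons_val_one,
    Real.cos_add, Real.sin_add, Real.cos_pi_div_three, Real.sin_pi_div_three]
  linear_combination (Real.sin t ^ 2 + Real.cos t ^ 2) / 4 * h3 + h

lemma circPt_injOn (x : EuclideanSpace ℝ (Fin 2)) :
    Set.InjOn (circPt x) (Set.Icc 0 Real.pi) := by
  intro s hs t ht h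
  have h0 := congrArg (fun v : EuclideanSpace ℝ (Fin 2) => v 0) h
  simp [circPt] at h0
  exact Real.injOn_cos hs ht h0

/-- A color of an interior point on the unit circle around `x` is not in the multicolor of `x`. -/
lemma not_mem_multicolor (c : EuclideanSpace ℝ (Fin 2) → Fin 6)
    (hc : ∀ x y : EuclideanSpace ℝ (Fin 2), dist x y = 1 → c x ≠ c y)
    (x y : EuclideanSpace ℝ (Fin 2)) (hxy : dist y x = 1) (i : Fin 6)
    (hy : y ∈ interior (c ⁻¹' {i})) : x ∉ closure (interior (c ⁻¹' {i})) := by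
  intro hx
  have hcont : Continuous (fun z : EuclideanSpace ℝ (Fin 2) => z + (y - x)) := by fun_prop
  have ho : IsOpen ((fun z : EuclideanSpace ℝ (Fin 2) => z + (y - x)) ⁻¹'
      interior (c ⁻¹' {i})) := isOpen_interior.preimage hcont
  obtain ⟨z, hz1, hz2⟩ := mem_closure_iff.1 hx _ ho (by simpa using hy)
  have h1 : c (z + (y - x)) = i := interior_subset (s := c ⁻¹' {i}) hz1
  have h2 : c z = i := interior_subset (s := c ⁻¹' {i}) hz2
  refine hc (z + (y - x)) z ?_ (h1.trans h2.symm)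
  rw [dist_eq_norm] at hxy ⊢
  simpa using hxy

/-- Under the forbidden-arcs condition, no point of a proper 6-coloring has chromaticity
greater than 4. -/
theorem stmt_6 (c : EuclideanSpace ℝ (Fin 2) → Fin 6)
    (hc : ∀ x y : EuclideanSpace ℝ (Fin 2), dist x y = 1 → c x ≠ c y)
    (hfa : ∀ v : EuclideanSpace ℝ (Fin 2),
      (Metric.sphere v 1 ∩ ⋃ i : Fin 6, frontier (c ⁻¹' {i})).Finite)
    (x : EuclideanSpace ℝ (Fin 2)) :
    ({i : Fin 6 | x ∈ closure (interior (c ⁻¹' {i}))}).ncard ≤ 4 := by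
  set M := {i : Fin 6 | x ∈ closure (interior (c ⁻¹' {i}))} with hM
  set F := Metric.sphere x 1 ∩ ⋃ i : Fin 6, frontier (c ⁻¹' {i}) with hF
  have hfin : F.Finite := hfa x
  have hpi := Real.pi_gt_three
  have key : ∀ t, circPt x t ∉ F → c (circPt x t) ∈ Mᶜ := by
    intro t ht
    apply not_mem_multicolor c hc x (circPt x t) (circPt_dist x t)
    by_contra hn
    exact ht ⟨circPt_dist x t, Set.mem_iUnion.2 ⟨c (circPt x t), subset_closure rfl, hn⟩⟩
  have f1 : (Set.Ioo (0 : ℝ) 1 ∩ circPt x ⁻¹' F).Finite := by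
    refine Set.Finite.of_finite_image (hfin.subset ?_) (f := circPt x) ?_
    · rintro _ ⟨t, ht, rfl⟩
      exact ht.2
    · exact (circPt_injOn x).mono (by rintro t ⟨⟨h1, h2⟩, -⟩; exact ⟨h1.le, by linarith⟩)
  have f2 : (Set.Ioo (0 : ℝ) 1 ∩ (fun t => circPt x (t + Real.pi / 3)) ⁻¹' F).Finite := by
    refine Set.Finite.of_finite_image (hfin.subset ?_)
      (f := fun t => circPt x (t + Real.pi / 3)) ?_
    · rintro _ ⟨t, ht, rfl⟩
      exact ht.2
    · intro s hs t ht h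
      have := circPt_injOn x ⟨by linarith [hs.1.1], by linarith [hs.1.2]⟩
        ⟨by linarith [ht.1.1], by linarith [ht.1.2]⟩ h
      linarith
  obtain ⟨t, ht, hnt⟩ := (Set.Ioo_infinite (zero_lt_one (α := ℝ))).exists_notMem_finite
    (f1.union f2)
  have k1 := key t fun h => hnt (Or.inl ⟨ht, h⟩)
  have k2 := key (t + Real.pi / 3) fun h => hnt (Or.inr ⟨ht, h⟩)
  have hne := hc _ _ (circPt_dist_two x t)
  have hcard : 1 < Mᶜ.ncard := (Set.one_lt_ncard (Set.toFinite _)).2 ⟨_, k1, _, k2, hne⟩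
  have hadd := Set.ncard_add_ncard_compl M
  rw [Nat.card_eq_fintype_card, Fintype.card_fin] at hadd
  omega
end

section
/- Let c be a proper coloring of the plane with 6 colors satisfying the forbidden-arcs condition. Then no point has chromaticity 4 or more: for every point x, the set {i : Fin 6 | x ∈ closure (interior (c ⁻¹' {i}))} has at most 3 elements. -/
open Filter Topology

namespace Arcs

/-- The point of the unit circle around `v` in direction `θ`. -/
noncomputable def pt (v : ℂ) (θ : ℝ) : ℂ := v + Complex.exp (θ * Complex.I)

/-- The half-arc of the unit circle around `v`, starting in direction `θ` and running in the
direction of the sign `s`, lies initially in the interior of color `i`. -/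
def HA (c : ℂ → Fin 6) (v : ℂ) (θ s : ℝ) (i : Fin 6) : Prop :=
  ∀ᶠ t in 𝓝[>] (0 : ℝ), pt v (θ + s * t) ∈ interior (c ⁻¹' {i})

/-- Color `i` belongs to the multicolor of `x`. -/
def MC (c : ℂ → Fin 6) (x : ℂ) (i : Fin 6) : Prop := x ∈ closure (interior (c ⁻¹' {i}))

lemma pt_cont (v : ℂ) : Continuous (pt v) := by
  unfold pt; fun_prop

lemma dist_pt (v : ℂ) (θ : ℝ) : dist v (pt v θ) = 1 := by
  simp [pt, dist_eq_norm, Complex.norm_exp_ofReal_mul_I]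

lemma pt_add_two_pi (v : ℂ) (θ : ℝ) : pt v (θ + 2 * Real.pi) = pt v θ := by
  unfold pt
  push_cast
  rw [add_mul, Complex.exp_add, Complex.exp_two_pi_mul_I, mul_one]

lemma dist_sq (x y : ℂ) : dist x y ^ 2 = (x.re - y.re) ^ 2 + (x.im - y.im) ^ 2 := by
  rw [Complex.dist_eq, Complex.sq_norm, Complex.normSq_apply]; simp; ring

lemma pt_re (v : ℂ) (θ : ℝ) : (pt v θ).re = v.re + Real.cos θ := by
  simp [pt, Complex.exp_ofReal_mul_I_re]

lemma pt_im (v : ℂ) (θ : ℝ) : (pt v θ).im = v.im + Real.sin θ := by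
  simp [pt, Complex.exp_ofReal_mul_I_im]

lemma dist_pt_pt (v : ℂ) (θ ψ : ℝ) :
    dist (pt v θ) (pt v (θ + ψ)) ^ 2 = 2 - 2 * Real.cos ψ := by
  rw [dist_sq]
  simp only [pt_re, pt_im, Real.cos_add, Real.sin_add]
  have h1 := Real.sin_sq_add_cos_sq θ
  have h2 := Real.sin_sq_add_cos_sq ψ
  linear_combination (1 + Real.sin ψ ^2 + Real.cos ψ ^2 - 2 * Real.cos ψ) * h1 + h2

lemma dist_sixty (v : ℂ) (θ : ℝ) : dist (pt v θ) (pt v (θ + Real.pi / 3)) = 1 := by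
  have h := dist_pt_pt v θ (Real.pi / 3)
  rw [Real.cos_pi_div_three] at h
  have : (0:ℝ) ≤ dist (pt v θ) (pt v (θ + Real.pi / 3)) := dist_nonneg
  nlinarith

lemma dist_center (x : ℂ) (φ ψ : ℝ) :
    dist x (pt (pt x φ) (φ + ψ)) ^ 2 = 2 + 2 * Real.cos ψ := by
  rw [dist_sq]
  simp only [pt_re, pt_im, Real.cos_add, Real.sin_add]
  have h1 := Real.sin_sq_add_cos_sq φ
  have h2 := Real.sin_sq_add_cos_sq ψ
  linear_combination (1 + Real.sin ψ ^2 + Real.cos ψ ^2 + 2 * Real.cos ψ) * h1 + h2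

lemma cos_two : Real.cos (2 * (Real.pi / 3)) = -(1/2) := by
  rw [Real.cos_two_mul, Real.cos_pi_div_three]; norm_num

lemma sin_two : Real.sin (2 * (Real.pi / 3)) = Real.sqrt 3 / 2 := by
  rw [Real.sin_two_mul, Real.cos_pi_div_three, Real.sin_pi_div_three]; ring

lemma hex (x : ℂ) (φ σ : ℝ) (hσ : σ = 1 ∨ σ = -1) :
    pt (pt x φ) (φ + σ * (2 * (Real.pi / 3))) = pt x (φ + σ * (Real.pi / 3)) := by
  apply Complex.ext <;> simp only [pt_re, pt_im, Real.cos_add, Real.sin_add] <;>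
  rcases hσ with rfl | rfl <;>
  simp only [one_mul, neg_mul, Real.cos_neg, Real.sin_neg, cos_two, sin_two,
    Real.cos_pi_div_three, Real.sin_pi_div_three] <;> ring

lemma cos_sigma (σ u : ℝ) (hσ : σ = 1 ∨ σ = -1) : Real.cos (σ * u) = Real.cos u := by
  rcases hσ with rfl | rfl <;> simp

lemma inside (x : ℂ) (φ σ t : ℝ) (hσ : σ = 1 ∨ σ = -1) (h0 : 0 < t) (h1 : t < 1) :
    dist x (pt (pt x φ) (φ + σ * (2 * (Real.pi / 3)) + σ * t)) < 1 := by
  have h := dist_center x φ (σ * (2 * (Real.pi / 3) + t))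
  rw [cos_sigma _ _ hσ] at h
  have hp := Real.pi_gt_three
  have : Real.cos (2 * (Real.pi / 3) + t) < Real.cos (2 * (Real.pi / 3)) :=
    Real.strictAntiOn_cos ⟨by linarith, by linarith⟩ ⟨by linarith, by linarith⟩ (by linarith)
  rw [cos_two] at this
  rw [show φ + σ * (2 * (Real.pi / 3)) + σ * t = φ + σ * (2 * (Real.pi / 3) + t) by ring]
  nlinarith [dist_nonneg (x := x) (y := pt (pt x φ) (φ + σ * (2 * (Real.pi / 3) + t)))]

lemma outside (x : ℂ) (φ σ t : ℝ) (hσ : σ = 1 ∨ σ = -1) (h0 : 0 < t) (h1 : t < 1) :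
    1 < dist x (pt (pt x φ) (φ + σ * (2 * (Real.pi / 3)) + (-σ) * t)) := by
  have h := dist_center x φ (σ * (2 * (Real.pi / 3) - t))
  rw [cos_sigma _ _ hσ] at h
  have hp := Real.pi_gt_three
  have : Real.cos (2 * (Real.pi / 3)) < Real.cos (2 * (Real.pi / 3) - t) :=
    Real.strictAntiOn_cos ⟨by linarith, by linarith⟩ ⟨by linarith, by linarith⟩ (by linarith)
  rw [cos_two] at this
  rw [show φ + σ * (2 * (Real.pi / 3)) + (-σ) * t = φ + σ * (2 * (Real.pi / 3) - t) by ring]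
  nlinarith [dist_nonneg (x := x) (y := pt (pt x φ) (φ + σ * (2 * (Real.pi / 3) - t)))]

lemma pt_inj (v : ℂ) (θ s : ℝ) (hs : s = 1 ∨ s = -1) :
    Set.InjOn (fun t : ℝ => pt v (θ + s * t)) (Set.Ioo 0 1) := by
  intro a ha b hb h
  simp only [pt] at h
  have h := add_left_cancel h
  push_cast at h
  rw [add_mul, add_mul, Complex.exp_add, Complex.exp_add] at h
  have h := mul_left_cancel₀ (Complex.exp_ne_zero _) h
  have hp := Real.pi_gt_three
  obtain ⟨ha0, ha1⟩ := ha
  obtain ⟨hb0, hb1⟩ := hb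
  have := Complex.exp_inj_of_neg_pi_lt_of_le_pi (x := (s:ℂ) * a * Complex.I)
    (y := (s:ℂ) * b * Complex.I) ?_ ?_ ?_ ?_ h
  · have := congrArg Complex.im this
    rcases hs with rfl | rfl <;> simpa using this
  all_goals rcases hs with rfl | rfl <;> simp <;> linarith

section
variable {c : ℂ → Fin 6} (hc : ∀ x y : ℂ, dist x y = 1 → c x ≠ c y)
    (hfa : ∀ v : ℂ, (Metric.sphere v 1 ∩ ⋃ i : Fin 6, frontier (c ⁻¹' {i})).Finite)

lemma mem_int {y : ℂ} (h : y ∉ ⋃ i : Fin 6, frontier (c ⁻¹' {i})) :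
    y ∈ interior (c ⁻¹' {c y}) := by
  simp only [Set.mem_iUnion, not_exists, frontier, Set.mem_sdiff, not_and, not_not] at h
  exact h _ (subset_closure rfl)

lemma col {y : ℂ} {i : Fin 6} (h : y ∈ interior (c ⁻¹' {i})) : c y = i := by
  have := interior_subset h
  simpa using this

include hc in
lemma weak_proper {x y : ℂ} {i : Fin 6} (hx : MC c x i) (hy : y ∈ interior (c ⁻¹' {i})) :
    dist x y ≠ 1 := by
  intro hd
  have h1 : ∃ᶠ p in 𝓝 x, p ∈ interior (c ⁻¹' {i}) := mem_closure_iff_frequently.1 hx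
  have h2 : ∀ᶠ p in 𝓝 x, y + (p - x) ∈ interior (c ⁻¹' {i}) := by
    have : ContinuousAt (fun p : ℂ => y + (p - x)) x := by fun_prop
    apply this.eventually_mem
    simpa using isOpen_interior.mem_nhds hy
  obtain ⟨p, hp, hq⟩ := (h1.and_eventually h2).exists
  refine hc p (y + (p - x)) ?_ ((col hp).trans (col hq).symm)
  rw [← hd, dist_eq_norm, dist_eq_norm]; congr 1; ring

lemma tendsto_pt (v : ℂ) (θ s : ℝ) :
    Tendsto (fun t : ℝ => pt v (θ + s * t)) (𝓝[>] 0) (𝓝 (pt v θ)) := by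
  have : Continuous (fun t : ℝ => pt v (θ + s * t)) := (pt_cont v).comp (by fun_prop)
  have := this.tendsto 0
  simp only [mul_zero, add_zero] at this
  exact this.mono_left nhdsWithin_le_nhds

include hfa in
lemma exists_HA (v : ℂ) (θ s : ℝ) (hs : s = 1 ∨ s = -1) : ∃ i, HA c v θ s i := by
  set B := ⋃ i : Fin 6, frontier (c ⁻¹' {i}) with hB
  set γ : ℝ → ℂ := fun t => pt v (θ + s * t) with hγ
  have hγc : Continuous γ := (pt_cont v).comp (by fun_prop)
  have hfin : (Set.Ioo 0 1 ∩ γ ⁻¹' (Metric.sphere v 1 ∩ B)).Finite := by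
    refine Set.Finite.of_finite_image ((hfa v).subset ?_)
      ((pt_inj v θ s hs).mono Set.inter_subset_left)
    rintro _ ⟨t, ht, rfl⟩
    exact ht.2
  have h1 : ∀ᶠ t in 𝓝[>] (0:ℝ), t ∉ (Set.Ioo 0 1 ∩ γ ⁻¹' (Metric.sphere v 1 ∩ B)) :=
    nhdsWithin_le_nhds (hfin.isClosed.isOpen_compl.mem_nhds (by simp))
  have h2 : ∀ᶠ t in 𝓝[>] (0:ℝ), t ∈ Set.Ioo (0:ℝ) 1 := Ioo_mem_nhdsGT one_pos
  have h3 : ∀ᶠ t in 𝓝[>] (0:ℝ), γ t ∈ interior (c ⁻¹' {c (γ t)}) := by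
    filter_upwards [h1, h2] with t ht1 ht2
    apply mem_int
    intro hb
    refine ht1 ⟨ht2, ?_, hb⟩
    rw [Metric.mem_sphere, dist_comm]
    exact dist_pt _ _
  obtain ⟨ε, hε, hsub⟩ := (mem_nhdsGT_iff_exists_Ioo_subset).1 h3
  have hε : (0:ℝ) < ε := hε
  have hcont : ContinuousOn (fun t => c (γ t)) (Set.Ioo 0 ε) := by
    intro t ht
    apply ContinuousAt.continuousWithinAt
    have h4 : ∀ᶠ u in 𝓝 t, γ u ∈ interior (c ⁻¹' {c (γ t)}) :=
      hγc.continuousAt.eventually_mem (isOpen_interior.mem_nhds (hsub ht))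
    have h5 : (fun u => c (γ u)) =ᶠ[𝓝 t] fun _ => c (γ t) := h4.mono fun u hu => col hu
    exact continuousAt_const.congr h5.symm
  refine ⟨c (γ (ε / 2)), ?_⟩
  refine Filter.mem_of_superset (Ioo_mem_nhdsGT hε) ?_
  intro t ht
  have := isPreconnected_Ioo.constant hcont ht (show ε / 2 ∈ Set.Ioo 0 ε by constructor <;> linarith)
  have h6 := hsub ht
  simp only [Set.mem_ofPred_eq] at h6 this ⊢
  rw [this] at h6
  exact h6

lemma HA_MC {v : ℂ} {θ s : ℝ} {i : Fin 6} (h : HA c v θ s i) : MC c (pt v θ) i :=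
  mem_closure_of_tendsto (tendsto_pt v θ s) h

include hc in
lemma HA_not_MC {v : ℂ} {θ s : ℝ} {i : Fin 6} (h : HA c v θ s i) : ¬ MC c v i := by
  intro hm
  obtain ⟨t, ht⟩ := h.exists
  exact weak_proper hc hm ht (dist_pt _ _)

include hc in
lemma HA_sixty {v : ℂ} {θ s : ℝ} {i j : Fin 6} (h : HA c v θ s i)
    (h' : HA c v (θ + Real.pi / 3) s j) : i ≠ j := by
  rintro rfl
  obtain ⟨t, ht, ht'⟩ := (h.and h').exists
  refine hc _ _ (dist_sixty v (θ + s * t)) ?_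
  rw [show θ + s * t + Real.pi / 3 = θ + Real.pi / 3 + s * t by ring, col ht, col ht']

lemma HA_period {v : ℂ} {θ s : ℝ} {i : Fin 6} (h : HA c v θ s i) :
    HA c v (θ + 2 * Real.pi) s i := by
  refine Eventually.mono h fun t ht => ?_
  rwa [show θ + 2 * Real.pi + s * t = θ + s * t + 2 * Real.pi by ring, pt_add_two_pi]

include hc in
lemma cross_in {x : ℂ} {φ σ : ℝ} {i : Fin 6} (hσ : σ = 1 ∨ σ = -1)
    (h : HA c (pt x φ) (φ + σ * (2 * (Real.pi / 3))) σ i) :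
    ∀ᶠ z in 𝓝 x, c z = i → dist z (pt x (φ + σ * (Real.pi / 3))) ≤ 1 := by
  obtain ⟨ε, hε, hsub⟩ := (mem_nhdsGT_iff_exists_Ioo_subset).1 h
  have hε : (0:ℝ) < ε := hε
  set γ : ℝ → ℂ := fun t => pt (pt x φ) (φ + σ * (2 * (Real.pi / 3)) + σ * t) with hγ
  have hγc : Continuous γ := (pt_cont _).comp (by fun_prop)
  obtain ⟨t, ht0, ht⟩ := exists_between (lt_min hε one_pos)
  have htε := ht.trans_le (min_le_left _ _)
  have ht1 := ht.trans_le (min_le_right _ _)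
  have h1 : dist x (γ t) < 1 := inside x φ σ t hσ ht0 ht1
  have h2 : ∀ᶠ z in 𝓝 x, dist z (γ t) < 1 :=
    (Continuous.tendsto (by fun_prop) x).eventually_lt_const h1
  filter_upwards [h2] with z hz hzi
  by_contra! hcon
  rw [← hex x φ σ hσ] at hcon
  have hcon : 1 < dist z (γ 0) := by simpa [hγ] using hcon
  obtain ⟨u, hu, hu1⟩ := intermediate_value_Ioo' ht0.le
    (f := fun u => dist z (γ u)) (by fun_prop) ⟨hz, hcon⟩
  refine hc z (γ u) hu1 ?_
  rw [hzi]
  exact (col (hsub ⟨hu.1, hu.2.trans htε⟩)).symm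

include hc in
lemma cross_out {x : ℂ} {φ σ : ℝ} {i : Fin 6} (hσ : σ = 1 ∨ σ = -1)
    (h : HA c (pt x φ) (φ + σ * (2 * (Real.pi / 3))) (-σ) i) :
    ∀ᶠ z in 𝓝 x, c z = i → 1 ≤ dist z (pt x (φ + σ * (Real.pi / 3))) := by
  obtain ⟨ε, hε, hsub⟩ := (mem_nhdsGT_iff_exists_Ioo_subset).1 h
  have hε : (0:ℝ) < ε := hε
  set γ : ℝ → ℂ := fun t => pt (pt x φ) (φ + σ * (2 * (Real.pi / 3)) + (-σ) * t) with hγ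
  have hγc : Continuous γ := (pt_cont _).comp (by fun_prop)
  obtain ⟨t, ht0, ht⟩ := exists_between (lt_min hε one_pos)
  have htε := ht.trans_le (min_le_left _ _)
  have ht1 := ht.trans_le (min_le_right _ _)
  have h1 : 1 < dist x (γ t) := outside x φ σ t hσ ht0 ht1
  have h2 : ∀ᶠ z in 𝓝 x, 1 < dist z (γ t) :=
    (Continuous.tendsto (by fun_prop) x).eventually_const_lt h1
  filter_upwards [h2] with z hz hzi
  by_contra! hcon
  rw [← hex x φ σ hσ] at hcon
  have hcon : dist z (γ 0) < 1 := by simpa [hγ] using hcon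
  obtain ⟨u, hu, hu1⟩ := intermediate_value_Ioo ht0.le
    (f := fun u => dist z (γ u)) (by fun_prop) ⟨hcon, hz⟩
  refine hc z (γ u) hu1 ?_
  rw [hzi]
  exact (col (hsub ⟨hu.1, hu.2.trans htε⟩)).symm

lemma freq_generic {x : ℂ} {i : Fin 6} (h : MC c x i) (p q r : ℂ) :
    ∃ᶠ z in 𝓝 x, c z = i ∧ dist z p ≠ 1 ∧ dist z q ≠ 1 ∧ dist z r ≠ 1 := by
  have hd : ∀ w : ℂ, Dense (Metric.sphere w 1)ᶜ := fun w => by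
    rw [← interior_eq_empty_iff_dense_compl]
    exact interior_sphere w one_ne_zero
  have ho : ∀ w : ℂ, IsOpen (Metric.sphere w 1)ᶜ := fun w => Metric.isClosed_sphere.isOpen_compl
  have hD := ((hd p).inter_of_isOpen_left (hd q) (ho p)).inter_of_isOpen_left (hd r)
    ((ho p).inter (ho q))
  have := hD.open_subset_closure_inter (isOpen_interior (s := c ⁻¹' {i}))
  have hx : x ∈ closure (interior (c ⁻¹' {i}) ∩ _) := closure_minimal this isClosed_closure h
  refine (mem_closure_iff_frequently.1 hx).mono ?_
  rintro z ⟨hz, ⟨hp, hq⟩, hr⟩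
  exact ⟨col hz, hp, hq, hr⟩

include hc in
lemma in_ne_out {x : ℂ} {φ σ : ℝ} {i j : Fin 6} (hσ : σ = 1 ∨ σ = -1) (hi : MC c x i)
    (h : HA c (pt x φ) (φ + σ * (2 * (Real.pi / 3))) σ i)
    (h' : HA c (pt x φ) (φ + σ * (2 * (Real.pi / 3))) (-σ) j) : i ≠ j := by
  rintro rfl
  set y := pt x (φ + σ * (Real.pi / 3))
  obtain ⟨z, ⟨hz, hy, -⟩, h1, h2⟩ := ((freq_generic hi y y y).and_eventually
    ((cross_in hc hσ h).and (cross_out hc hσ h'))).exists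
  exact hy (le_antisymm (h1 hz) (h2 hz))

include hc hfa in
/-- If the half-arcs of `v` have only colors `a`, `b`, then rotating by 120 degrees keeps them. -/
lemma HA_rot {v : ℂ} {θ s : ℝ} {a b i : Fin 6} (hs : s = 1 ∨ s = -1)
    (hab : ∀ θ s i, HA c v θ s i → i = a ∨ i = b) (h : HA c v θ s i) :
    HA c v (θ + 2 * (2 * (Real.pi / 3))) s i := by
  have aux : ∀ ψ i, HA c v ψ s i → HA c v (ψ + 2 * (Real.pi / 3)) s i := by
    intro ψ i h
    obtain ⟨j, hj⟩ := exists_HA hfa v (ψ + Real.pi / 3) s hs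
    obtain ⟨k, hk⟩ := exists_HA hfa v (ψ + Real.pi / 3 + Real.pi / 3) s hs
    have h1 := HA_sixty hc h hj
    have h2 := HA_sixty hc hj hk
    have e1 := hab _ _ _ h
    have e2 := hab _ _ _ hj
    have e3 := hab _ _ _ hk
    have : i = k := by grind
    subst this
    convert hk using 1; ring
  have := aux _ _ (aux _ _ h)
  convert this using 1; ring

include hc hfa in
lemma parity {x : ℂ} {φ : ℝ} {a b : Fin 6} (hb : MC c x b)
    (hab : ∀ θ s i, HA c (pt x φ) θ s i → i = a ∨ i = b) :
    ∀ᶠ z in 𝓝 x, c z = a → dist z (pt x (φ - Real.pi / 3)) ≠ 1 →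
      dist z (pt x (φ + Real.pi / 3)) ≠ 1 →
      (dist z (pt x (φ - Real.pi / 3)) < 1 ↔ 1 < dist z (pt x (φ + Real.pi / 3))) := by
  have m1 : (-1 : ℝ) = 1 ∨ (-1 : ℝ) = -1 := Or.inr rfl
  have p1 : (1 : ℝ) = 1 ∨ (1 : ℝ) = -1 := Or.inl rfl
  obtain ⟨i, hi⟩ := exists_HA hfa (pt x φ) (φ + (-1) * (2 * (Real.pi / 3))) (-1) m1
  obtain ⟨o, ho⟩ := exists_HA hfa (pt x φ) (φ + (-1) * (2 * (Real.pi / 3))) 1 p1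
  have ei : φ + (-1) * (2 * (Real.pi / 3)) + 2 * (2 * (Real.pi / 3))
    = φ + 1 * (2 * (Real.pi / 3)) := by ring
  have hi' := HA_rot hc hfa m1 hab hi
  have ho' := HA_rot hc hfa p1 hab ho
  rw [ei] at hi' ho'
  have e1 : φ + (-1) * (Real.pi / 3) = φ - Real.pi / 3 := by ring
  have e2 : φ + 1 * (Real.pi / 3) = φ + Real.pi / 3 := by ring
  rcases hab _ _ _ hi with rfl | rfl
  · have q1 := cross_in hc m1 hi
    have q2 := cross_out hc p1 hi'
    rw [e1] at q1; rw [e2] at q2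
    filter_upwards [q1, q2] with z h1 h2 hz n1 n2
    exact ⟨fun _ => lt_of_le_of_ne (h2 hz) n2.symm, fun _ => lt_of_le_of_ne (h1 hz) n1⟩
  · have hne := in_ne_out hc m1 hb hi (by simpa using ho)
    rcases hab _ _ _ ho with rfl | rfl
    · have q1 := cross_out hc m1 (by simpa using ho)
      have q2 := cross_in hc p1 ho'
      rw [e1] at q1; rw [e2] at q2
      filter_upwards [q1, q2] with z h1 h2 hz n1 n2
      exact ⟨fun h => absurd h (not_lt.2 (h1 hz)), fun h => absurd h (not_lt.2 (h2 hz))⟩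
    · exact absurd rfl hne

include hc hfa in
lemma exists_switch (x : ℂ) : ∃ θ p q, HA c x θ (-1) p ∧ HA c x θ 1 q ∧ p ≠ q := by
  by_contra! hcon
  have m1 : (-1 : ℝ) = 1 ∨ (-1 : ℝ) = -1 := Or.inr rfl
  have p1 : (1 : ℝ) = 1 ∨ (1 : ℝ) = -1 := Or.inl rfl
  choose R hR using fun θ => exists_HA hfa x θ 1 p1
  have hL : ∀ θ, HA c x θ (-1) (R θ) := by
    intro θ
    obtain ⟨p, hp⟩ := exists_HA hfa x θ (-1) m1
    rwa [← hcon θ p (R θ) hp (hR θ)]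
  have key : ∀ θ i, pt x θ ∈ interior (c ⁻¹' {i}) → R θ = i := by
    intro θ i hi
    have : ∀ᶠ t in 𝓝[>] (0 : ℝ), pt x (θ + 1 * t) ∈ interior (c ⁻¹' {i}) :=
      (tendsto_pt x θ 1).eventually_mem (isOpen_interior.mem_nhds hi)
    obtain ⟨t, h1, h2⟩ := ((hR θ).and this).exists
    rw [← col h1, ← col h2]
  have hlc : IsLocallyConstant R := by
    rw [IsLocallyConstant.iff_eventually_eq]
    intro θ
    obtain ⟨ε, hε, h1⟩ := (mem_nhdsGT_iff_exists_Ioo_subset).1 (hR θ)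
    obtain ⟨δ, hδ, h2⟩ := (mem_nhdsGT_iff_exists_Ioo_subset).1 (hL θ)
    have hε : (0:ℝ) < ε := hε
    have hδ : (0:ℝ) < δ := hδ
    filter_upwards [Ioo_mem_nhds (show θ - δ < θ by linarith) (show θ < θ + ε by linarith)]
      with u hu
    rcases lt_trichotomy u θ with h | h | h
    · apply key
      have := h2 (show θ - u ∈ Set.Ioo 0 δ from ⟨by linarith, by linarith [hu.1]⟩)
      simpa using this
    · rw [h]
    · apply key
      have := h1 (show u - θ ∈ Set.Ioo 0 ε from ⟨by linarith, by linarith [hu.2]⟩)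
      simpa using this
  exact HA_sixty hc (hR 0) (hR (0 + Real.pi / 3)) (hlc.apply_eq_of_preconnectedSpace _ _)


lemma exists_rest {p q a b : Fin 6} (hpq : p ≠ q) (hab : a ≠ b) (hap : a ≠ p) (haq : a ≠ q)
    (hbp : b ≠ p) (hbq : b ≠ q) :
    ∃ d e : Fin 6, ∀ i, i = p ∨ i = q ∨ i = a ∨ i = b ∨ i = d ∨ i = e := by
  have h : ((({p, q, a, b} : Finset (Fin 6)))ᶜ).card = 2 := by
    rw [Finset.card_compl, Finset.card_insert_of_notMem, Finset.card_insert_of_notMem,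
      Finset.card_insert_of_notMem, Finset.card_singleton] <;> simp <;> grind
  obtain ⟨d, e, -, hde⟩ := Finset.card_eq_two.1 h
  refine ⟨d, e, fun i => ?_⟩
  by_cases hi : i ∈ (({p, q, a, b} : Finset (Fin 6)))ᶜ
  · rw [hde] at hi
    simp at hi
    tauto
  · simp at hi
    grind

include hc hfa in
lemma step {x : ℂ} {p q : Fin 6} (hM : ∀ i, i ≠ p → i ≠ q → MC c x i) {φ : ℝ}
    (hp : MC c (pt x φ) p) (hq : MC c (pt x φ) q) :
    ∃ i j, i ≠ j ∧ ¬ MC c (pt x φ) i ∧ ¬ MC c (pt x φ) j ∧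
      MC c (pt x (φ + Real.pi / 3)) i ∧ MC c (pt x (φ + Real.pi / 3)) j := by
  have m1 : (-1 : ℝ) = 1 ∨ (-1 : ℝ) = -1 := Or.inr rfl
  have p1 : (1 : ℝ) = 1 ∨ (1 : ℝ) = -1 := Or.inl rfl
  obtain ⟨i, hi⟩ := exists_HA hfa (pt x φ) (φ + 1 * (2 * (Real.pi / 3))) 1 p1
  obtain ⟨j, hj⟩ := exists_HA hfa (pt x φ) (φ + 1 * (2 * (Real.pi / 3))) (-1) m1
  have ni := HA_not_MC hc hi
  have nj := HA_not_MC hc hj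
  have e := hex x φ 1 p1
  rw [one_mul (Real.pi / 3)] at e
  refine ⟨i, j, in_ne_out hc p1 (hM i ?_ ?_) hi hj, ni, nj, ?_, ?_⟩
  · rintro rfl; exact ni hp
  · rintro rfl; exact ni hq
  · rw [← e]; exact HA_MC hi
  · rw [← e]; exact HA_MC hj

include hc hfa in
lemma step2 {x : ℂ} {p q a b d e : Fin 6} (hM : ∀ i, i ≠ p → i ≠ q → MC c x i)
    (hall : ∀ i, i = p ∨ i = q ∨ i = a ∨ i = b ∨ i = d ∨ i = e) {φ : ℝ}
    (hp : MC c (pt x φ) p) (hq : MC c (pt x φ) q) (ha : MC c (pt x φ) a)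
    (hb : MC c (pt x φ) b) :
    MC c (pt x (φ + Real.pi / 3)) d ∧ MC c (pt x (φ + Real.pi / 3)) e := by
  obtain ⟨i, j, hij, ni, nj, hi, hj⟩ := step hc hfa hM hp hq
  have h1 : i = d ∨ i = e := by
    rcases hall i with rfl | rfl | rfl | rfl | h | h <;> first | contradiction | tauto
  have h2 : j = d ∨ j = e := by
    rcases hall j with rfl | rfl | rfl | rfl | h | h <;> first | contradiction | tauto
  rcases h1 with rfl | rfl <;> rcases h2 with rfl | rfl <;> tauto

set_option maxHeartbeats 2000000 in
include hc hfa in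
lemma main_plane (x : ℂ) : ({i : Fin 6 | MC c x i}).ncard ≤ 3 := by
  by_contra! hcard
  obtain ⟨θ, p, q, hp, hq, hpq⟩ := exists_switch hc hfa x
  have m1 : (-1 : ℝ) = 1 ∨ (-1 : ℝ) = -1 := Or.inr rfl
  have p1 : (1 : ℝ) = 1 ∨ (1 : ℝ) = -1 := Or.inl rfl
  have np := HA_not_MC hc hp
  have nq := HA_not_MC hc hq
  have hM : ∀ i, i ≠ p → i ≠ q → MC c x i := by
    intro i hip hiq
    by_contra hi
    have hsub : {i : Fin 6 | MC c x i} ⊆ ((({p, q, i} : Finset (Fin 6))ᶜ : Finset (Fin 6)) :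
        Set (Fin 6)) := by
      intro j hj
      have hj : MC c x j := hj
      have h1 : j ≠ p := by rintro rfl; exact np hj
      have h2 : j ≠ q := by rintro rfl; exact nq hj
      have h3 : j ≠ i := by rintro rfl; exact hi hj
      simp [h1, h2, h3]
    have h := Set.ncard_le_ncard hsub (Finset.finite_toSet _)
    rw [Set.ncard_coe_finset, Finset.card_compl, Finset.card_insert_of_notMem,
      Finset.card_insert_of_notMem, Finset.card_singleton] at h
    · simp at h; omega
    · simpa using Ne.symm hiq
    · simp [hpq, Ne.symm hip]
  have hx : ∀ ψ s i, HA c x ψ s i → i = p ∨ i = q := by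
    intro ψ s i h
    by_contra! hcon
    exact HA_not_MC hc h (hM i hcon.1 hcon.2)
  have nxt : ∀ ψ, (∃ i j, i ≠ j ∧ HA c x ψ (-1) i ∧ HA c x ψ 1 j) →
      ∃ i j, i ≠ j ∧ HA c x (ψ + Real.pi / 3) (-1) i ∧ HA c x (ψ + Real.pi / 3) 1 j := by
    rintro ψ ⟨i, j, hij, hi, hj⟩
    obtain ⟨k, hk⟩ := exists_HA hfa x (ψ + Real.pi / 3) (-1) m1
    obtain ⟨l, hl⟩ := exists_HA hfa x (ψ + Real.pi / 3) 1 p1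
    refine ⟨k, l, ?_, hk, hl⟩
    have := HA_sixty hc hi hk
    have := HA_sixty hc hj hl
    have := hx _ _ _ hi
    have := hx _ _ _ hj
    have := hx _ _ _ hk
    have := hx _ _ _ hl
    grind
  have both : ∀ ψ, (∃ i j, i ≠ j ∧ HA c x ψ (-1) i ∧ HA c x ψ 1 j) →
      MC c (pt x ψ) p ∧ MC c (pt x ψ) q := by
    rintro ψ ⟨i, j, hij, hi, hj⟩
    have h1 := HA_MC hi
    have h2 := HA_MC hj
    rcases hx _ _ _ hi with rfl | rfl <;> rcases hx _ _ _ hj with rfl | rfl <;> tauto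
  have s0 : ∃ i j, i ≠ j ∧ HA c x θ (-1) i ∧ HA c x θ 1 j := ⟨p, q, hpq, hp, hq⟩
  have s1 := nxt _ s0
  have s2 := nxt _ s1
  have s3 := nxt _ s2
  have s4 := nxt _ s3
  have s5 := nxt _ s4
  have s6 := nxt _ s5
  obtain ⟨a, b, hab, na, nb, ha, hb⟩ := step hc hfa hM (both _ s0).1 (both _ s0).2
  have hap : a ≠ p := by rintro rfl; exact na (both _ s0).1
  have haq : a ≠ q := by rintro rfl; exact na (both _ s0).2
  have hbp : b ≠ p := by rintro rfl; exact nb (both _ s0).1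
  have hbq : b ≠ q := by rintro rfl; exact nb (both _ s0).2
  obtain ⟨d, e, hall⟩ := exists_rest hpq hab hap haq hbp hbq
  have hall' : ∀ i, i = p ∨ i = q ∨ i = d ∨ i = e ∨ i = a ∨ i = b := fun i => by
    have := hall i; tauto
  have t2 := step2 hc hfa hM hall (both _ s1).1 (both _ s1).2 ha hb
  have t3 := step2 hc hfa hM hall' (both _ s2).1 (both _ s2).2 t2.1 t2.2
  have t4 := step2 hc hfa hM hall (both _ s3).1 (both _ s3).2 t3.1 t3.2
  have t5 := step2 hc hfa hM hall' (both _ s4).1 (both _ s4).2 t4.1 t4.2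
  have t6 := step2 hc hfa hM hall (both _ s5).1 (both _ s5).2 t5.1 t5.2
  have two : ∀ φ, MC c (pt x φ) p ∧ MC c (pt x φ) q → MC c (pt x φ) d ∧ MC c (pt x φ) e →
      ∀ ψ s i, HA c (pt x φ) ψ s i → i = a ∨ i = b := by
    intro φ h1 h2 ψ s i hi
    have := HA_not_MC hc hi
    rcases hall i with rfl | rfl | h | h | rfl | rfl <;> tauto
  have hMb := hM b hbp hbq
  have q2 := parity hc hfa hMb (two _ (both _ s2) t2)
  have q4 := parity hc hfa hMb (two _ (both _ s4) t4)
  have q6 := parity hc hfa hMb (two _ (both _ s6) t6)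
  have e7 : pt x (θ + Real.pi / 3 + Real.pi / 3 + Real.pi / 3 + Real.pi / 3 + Real.pi / 3 +
      Real.pi / 3 + Real.pi / 3) = pt x (θ + Real.pi / 3) := by
    rw [← pt_add_two_pi x (θ + Real.pi / 3)]; congr 1; ring
  rw [e7] at q6
  simp only [add_sub_cancel_right] at q2 q4 q6
  obtain ⟨z, ⟨hz, n1, n3, n5⟩, r2, r4, r6⟩ := ((freq_generic (hM a hap haq) (pt x (θ + Real.pi / 3))
    (pt x (θ + Real.pi / 3 + Real.pi / 3 + Real.pi / 3))
    (pt x (θ + Real.pi / 3 + Real.pi / 3 + Real.pi / 3 + Real.pi / 3 + Real.pi / 3))).and_eventually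
    (q2.and (q4.and q6))).exists
  have r2 := r2 hz n1 n3
  have r4 := r4 hz n3 n5
  have r6 := r6 hz n5 n1
  have o1 := lt_or_gt_of_ne n1
  have o3 := lt_or_gt_of_ne n3
  have o5 := lt_or_gt_of_ne n5
  clear * - r2 r4 r6 o1 o3 o5
  generalize dist z (pt x (θ + Real.pi / 3)) = A at *
  generalize dist z _ = B at *
  generalize dist z _ = D at *
  rcases o1 with o1 | o1
  · have h3 := r2.1 o1
    have h5 : ¬ D < 1 := fun h => by linarith [r6.1 h]
    have h5' : 1 < D := o5.resolve_left h5
    linarith [r4.2 h5']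
  · have h5 := r6.2 o1
    have h3 : ¬ B < 1 := fun h => by linarith [r4.1 h]
    have h3' : 1 < B := o3.resolve_left h3
    linarith [r2.2 h3']

end
end Arcs

/-- Under the forbidden-arcs condition, no point of a proper 6-coloring has chromaticity
of 4 or more. -/
theorem stmt_7 (c : EuclideanSpace ℝ (Fin 2) → Fin 6)
    (hc : ∀ x y : EuclideanSpace ℝ (Fin 2), dist x y = 1 → c x ≠ c y)
    (hfa : ∀ v : EuclideanSpace ℝ (Fin 2),
      (Metric.sphere v 1 ∩ ⋃ i : Fin 6, frontier (c ⁻¹' {i})).Finite)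
    (x : EuclideanSpace ℝ (Fin 2)) :
    ({i : Fin 6 | x ∈ closure (interior (c ⁻¹' {i}))}).ncard ≤ 3 := by
  let f : ℂ ≃ₗᵢ[ℝ] EuclideanSpace ℝ (Fin 2) := Complex.orthonormalBasisOneI.repr
  let h : ℂ ≃ₜ EuclideanSpace ℝ (Fin 2) := f.toHomeomorph
  have hd : ∀ u v, dist (h u) (h v) = dist u v := fun u v => f.dist_map u v
  have key := Arcs.main_plane (c := fun u => c (h u))
    (fun u v huv => hc _ _ (by rw [hd]; exact huv)) ?_ (h.symm x)
  · refine le_of_eq_of_le ?_ key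
    congr 1
    ext i
    have e : (fun u => c (h u)) ⁻¹' {i} = h ⁻¹' (c ⁻¹' {i}) := rfl
    simp only [Set.mem_ofPred_eq, Arcs.MC]
    rw [e, ← h.preimage_interior, ← h.preimage_closure]
    simp
  · intro v
    refine Set.Finite.of_finite_image ((hfa (h v)).subset ?_) h.injective.injOn
    rintro _ ⟨u, ⟨hu, hu'⟩, rfl⟩
    refine ⟨?_, ?_⟩
    · rw [Metric.mem_sphere] at hu ⊢
      rw [hd]; exact hu
    · rw [Set.mem_iUnion] at hu' ⊢
      obtain ⟨i, hi⟩ := hu'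
      have e : (fun u => c (h u)) ⁻¹' {i} = h ⁻¹' (c ⁻¹' {i}) := rfl
      rw [e, ← h.preimage_frontier] at hi
      exact ⟨i, hi⟩
end

section
/- Let c be a proper coloring of the plane with 6 colors such that every point's color is realized by an adjacent region, i.e. w ∈ closure (interior (c ⁻¹' {c w})) for every point w. Let x, y, z be affinely independent points and let i be a color such that every point of the open segment from z to x and every point of the open segment from z to y has color i. Then there exist points p in the open segment from z to x and q in the open segment from z to y such that the recolored map c', defined by c' w = i if w ∈ interior (convexHull ℝ {p, q, z}) and c' w = c w otherwise, is again a proper coloring. -/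
open scoped Classical

abbrev E2 := EuclideanSpace ℝ (Fin 2)

set_option maxHeartbeats 1000000 in
lemma core_aux (m n k l c0 s r g1 g2 δ : ℝ) (hc0 : 0 < c0)
    (hdet : c0 ^ 2 * (2 * (m ^ 2 + n ^ 2 + k ^ 2 + l ^ 2)) ≤ (m * l - n * k) ^ 2)
    (hd0 : δ < 1 / 2)
    (hd1 : 2 * δ * (m ^ 2 + n ^ 2) ≤ c0) (hd3 : δ * |m * k + n * l| ≤ c0)
    (hs : 0 ≤ s) (hr : 0 ≤ r) (hsr : s + r ≤ δ)
    (hu : (s * m + r * k - g1) ^ 2 + (s * n + r * l - g2) ^ 2 = 1)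
    (hg : 1 < g1 ^ 2 + g2 ^ 2) (hab : k * g1 + l * g2 ≤ m * g1 + n * g2) :
    ∃ t, 0 < t ∧ t < 1 ∧ (t * m - g1) ^ 2 + (t * n - g2) ^ 2 ≤ 1 := by
  obtain ⟨a, ha⟩ : ∃ a, a = m * g1 + n * g2 := ⟨_, rfl⟩
  obtain ⟨b, hb⟩ : ∃ b, b = k * g1 + l * g2 := ⟨_, rfl⟩
  rw [← ha, ← hb] at hab
  have hv : 0 ≤ (s * m + r * k) ^ 2 + (s * n + r * l) ^ 2 := by positivity
  have key : g1 ^ 2 + g2 ^ 2 - 1 - 2 * (s * a + r * b)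
      + ((s * m + r * k) ^ 2 + (s * n + r * l) ^ 2) = 0 := by
    rw [ha, hb]; linear_combination hu
  have hpos : 0 < s * a + r * b := by linarith
  have hle : s * a + r * b ≤ (s + r) * a := by nlinarith
  by_cases hac : c0 ≤ a
  · have hσ : 0 < s + r := by
      by_contra h
      have : s = 0 := by linarith
      have : r = 0 := by linarith
      subst_vars; simp at hpos
    refine ⟨2 * (s + r), by linarith, by linarith, ?_⟩
    have e : (2 * (s + r) * m - g1) ^ 2 + (2 * (s + r) * n - g2) ^ 2
        = g1 ^ 2 + g2 ^ 2 - 4 * (s + r) * a + 4 * (s + r) ^ 2 * (m ^ 2 + n ^ 2) := by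
      rw [ha]; ring
    have h1 : 2 * (s + r) * (m ^ 2 + n ^ 2) ≤ a := by
      have : (s + r) * (m ^ 2 + n ^ 2) ≤ δ * (m ^ 2 + n ^ 2) := by gcongr
      linarith
    have h2 := mul_le_mul_of_nonneg_left h1 hσ.le
    rw [e]; nlinarith
  · push Not at hac
    have hbc : b ≤ -c0 := by
      by_contra hb'
      push Not at hb'
      have hbb : b ^ 2 < c0 ^ 2 := sq_lt_sq' (by linarith) (by linarith)
      have haa : a ^ 2 < c0 ^ 2 := sq_lt_sq' (by linarith) (by linarith)
      have e : (g1 ^ 2 + g2 ^ 2) * (m * l - n * k) ^ 2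
          = (a * k - b * m) ^ 2 + (a * l - b * n) ^ 2 := by
        rw [ha, hb]; ring
      have h1 : (a * k - b * m) ^ 2 + (a * l - b * n) ^ 2
          ≤ 2 * (a ^ 2 * (k ^ 2 + l ^ 2)) + 2 * (b ^ 2 * (m ^ 2 + n ^ 2)) := by
        nlinarith [sq_nonneg (a * k + b * m), sq_nonneg (a * l + b * n)]
      have h2 : a ^ 2 * (k ^ 2 + l ^ 2) ≤ c0 ^ 2 * (k ^ 2 + l ^ 2) := by gcongr
      have h3 : b ^ 2 * (m ^ 2 + n ^ 2) ≤ c0 ^ 2 * (m ^ 2 + n ^ 2) := by gcongr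
      have h4 : (g1 ^ 2 + g2 ^ 2) * (m * l - n * k) ^ 2 ≤ (m * l - n * k) ^ 2 := by
        rw [e]; linarith
      have h5 : (m * l - n * k) ^ 2 ≤ 0 := by
        by_contra h
        push Not at h
        have := mul_pos (sub_pos.mpr hg) h
        linarith
      have h6 : c0 ^ 2 * (2 * (m ^ 2 + n ^ 2 + k ^ 2 + l ^ 2)) ≤ 0 := by linarith
      have h7 : m ^ 2 + n ^ 2 + k ^ 2 + l ^ 2 ≤ 0 := by
        by_contra h; push Not at h
        have : 0 < c0 ^ 2 * (2 * (m ^ 2 + n ^ 2 + k ^ 2 + l ^ 2)) := by positivity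
        linarith
      have hm : m = 0 := pow_eq_zero_iff two_ne_zero |>.mp
        (by linarith [sq_nonneg m, sq_nonneg n, sq_nonneg k, sq_nonneg l])
      have hn : n = 0 := pow_eq_zero_iff two_ne_zero |>.mp
        (by linarith [sq_nonneg m, sq_nonneg n, sq_nonneg k, sq_nonneg l])
      have ha0 : a = 0 := by rw [ha, hm, hn]; ring
      rw [ha0] at hle hpos
      linarith
    have hspos : 0 < s := by
      rcases hs.lt_or_eq with h | h
      · exact h
      · rw [← h] at hpos; nlinarith
    refine ⟨s, hspos, by linarith, ?_⟩
    have hC : -c0 ≤ s * (m * k + n * l) := by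
      have h1 : s * |m * k + n * l| ≤ δ * |m * k + n * l| := by gcongr; linarith
      nlinarith [neg_abs_le (m * k + n * l)]
    have e : (s * m - g1) ^ 2 + (s * n - g2) ^ 2
        = 1 - 2 * (r * (s * (m * k + n * l) - b)) - r ^ 2 * (k ^ 2 + l ^ 2) := by
      rw [hb]; linear_combination hu
    have h1 : 0 ≤ r * (s * (m * k + n * l) - b) := mul_nonneg hr (by linarith)
    have h2 : 0 ≤ r ^ 2 * (k ^ 2 + l ^ 2) := by positivity
    linarith

lemma core (m n k l : ℝ) (hdet : m * l - n * k ≠ 0) :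
    ∃ δ, 0 < δ ∧ δ < 1 / 2 ∧ 16 * (δ ^ 2 * (m ^ 2 + n ^ 2)) < 1 ∧
      16 * (δ ^ 2 * (k ^ 2 + l ^ 2)) < 1 ∧
    ∀ s r g1 g2 : ℝ, 0 ≤ s → 0 ≤ r → s + r ≤ δ →
    (s * m + r * k - g1) ^ 2 + (s * n + r * l - g2) ^ 2 = 1 → 1 < g1 ^ 2 + g2 ^ 2 →
    ∃ t, 0 < t ∧ t < 1 ∧ ((t * m - g1) ^ 2 + (t * n - g2) ^ 2 ≤ 1 ∨
      (t * k - g1) ^ 2 + (t * l - g2) ^ 2 ≤ 1) := by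
  obtain ⟨M, hM⟩ : ∃ M, M = 1 + 2 * (m ^ 2 + n ^ 2 + k ^ 2 + l ^ 2) := ⟨_, rfl⟩
  have q1 := sq_nonneg m
  have q2 := sq_nonneg n
  have q3 := sq_nonneg k
  have q4 := sq_nonneg l
  have hM1 : 1 ≤ M := by rw [hM]; linarith
  obtain ⟨c0, hc0⟩ : ∃ c0, c0 = |m * l - n * k| / M := ⟨_, rfl⟩
  have hc0p : 0 < c0 := by rw [hc0]; have := abs_pos.mpr hdet; positivity
  have hc0M : c0 * M = |m * l - n * k| := by rw [hc0]; field_simp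
  have hdetc : c0 ^ 2 * M ≤ (m * l - n * k) ^ 2 := by
    rw [← sq_abs (m * l - n * k), ← hc0M]
    have : 0 < c0 ^ 2 * M := by positivity
    nlinarith
  have hdet1 : c0 ^ 2 * (2 * (m ^ 2 + n ^ 2 + k ^ 2 + l ^ 2)) ≤ (m * l - n * k) ^ 2 := by
    nlinarith
  obtain ⟨δ, hδ⟩ : ∃ δ, δ = min (1 / 8) (c0 / 8) / M := ⟨_, rfl⟩
  have hδM : δ * M = min (1 / 8) (c0 / 8) := by rw [hδ]; field_simp
  have hδp : 0 < δ := by rw [hδ]; positivity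
  have b1 : δ * M ≤ 1 / 8 := hδM ▸ min_le_left _ _
  have b2 : δ * M ≤ c0 / 8 := hδM ▸ min_le_right _ _
  have b3 : δ ≤ 1 / 8 := by nlinarith
  have u1 : δ * (m ^ 2 + n ^ 2) ≤ δ * M := by gcongr; linarith
  have u2 : δ * (k ^ 2 + l ^ 2) ≤ δ * M := by gcongr; linarith
  have u3 : δ * |m * k + n * l| ≤ δ * M := by
    gcongr
    rw [abs_le]
    constructor <;> nlinarith [sq_nonneg (m + k), sq_nonneg (n + l), sq_nonneg (m - k), sq_nonneg (n - l)]
  refine ⟨δ, hδp, by linarith, by nlinarith, by nlinarith, ?_⟩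
  intro s r g1 g2 hs hr hsr hu hg
  rcases le_total (k * g1 + l * g2) (m * g1 + n * g2) with h | h
  · obtain ⟨t, h1, h2, h3⟩ := core_aux m n k l c0 s r g1 g2 δ hc0p hdet1 (by linarith) (by linarith)
      (by linarith) hs hr hsr hu hg h
    exact ⟨t, h1, h2, Or.inl h3⟩
  · obtain ⟨t, h1, h2, h3⟩ := core_aux k l m n c0 r s g1 g2 δ hc0p (by nlinarith) (by linarith)
      (by linarith) (by rw [show k * m + l * n = m * k + n * l by ring]; linarith) hr hs (by linarith)
      (by linear_combination hu) hg h
    exact ⟨t, h1, h2, Or.inr h3⟩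

lemma det_ne (x y z : E2) (hind : AffineIndependent ℝ ![x, y, z]) :
    (x 0 - z 0) * (y 1 - z 1) - (x 1 - z 1) * (y 0 - z 0) ≠ 0 := by
  intro h
  rw [affineIndependent_iff] at hind
  have H : ∀ a b : ℝ, a • (x - z) + b • (y - z) = 0 → a = 0 ∧ b = 0 := by
    intro a b hab
    have := hind Finset.univ ![a, b, -a - b] (by simp [Fin.sum_univ_three])
      (by
        simp only [Fin.sum_univ_three, Matrix.cons_val_zero, Matrix.cons_val_one, Matrix.cons_val]
        rw [← hab]; module)
    exact ⟨by simpa using this 0 (Finset.mem_univ _), by simpa using this 1 (Finset.mem_univ _)⟩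
  have h1 := H (y 0 - z 0) (-(x 0 - z 0)) (by
    ext j; fin_cases j
    · simp; ring
    · simp; linear_combination -h)
  have h2 := H (y 1 - z 1) (-(x 1 - z 1)) (by
    ext j; fin_cases j
    · simp; linear_combination h
    · simp; ring)
  have h3 := H 1 0 (by
    ext j; fin_cases j
    · simp; linarith [h1.2]
    · simp; linarith [h2.2])
  exact one_ne_zero h3.1

lemma sign_aux (h : ℝ → ℝ) (hcont : Continuous h) (h0 : 0 < h 0)
    (hne : ∀ t, 0 < t → t < 1 → h t ≠ 0) : ∀ t, 0 < t → t < 1 → 0 < h t := by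
  intro t ht0 ht1
  by_contra hneg
  push Not at hneg
  obtain ⟨τ, hτ, hτ0⟩ := intermediate_value_Icc' ht0.le hcont.continuousOn
    (show (0 : ℝ) ∈ Set.Icc (h t) (h 0) from ⟨hneg, h0.le⟩)
  rcases hτ.1.lt_or_eq with hlt | heq
  · exact hne τ hlt (lt_of_le_of_lt hτ.2 ht1) hτ0
  · rw [← heq] at hτ0; linarith

lemma hull_mem (x y z : E2) (δ : ℝ) (hδ : 0 ≤ δ) (u : E2)
    (hu : u ∈ convexHull ℝ ({z + δ • (x - z), z + δ • (y - z), z} : Set E2)) :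
    ∃ s r : ℝ, 0 ≤ s ∧ 0 ≤ r ∧ s + r ≤ δ ∧ u = z + s • (x - z) + r • (y - z) := by
  have : convexHull ℝ ({z + δ • (x - z), z + δ • (y - z), z} : Set E2) ⊆
      {u | ∃ s r : ℝ, 0 ≤ s ∧ 0 ≤ r ∧ s + r ≤ δ ∧ u = z + s • (x - z) + r • (y - z)} := by
    apply convexHull_min
    · rintro v (rfl | rfl | rfl)
      · exact ⟨δ, 0, hδ, le_rfl, by simp, by simp⟩
      · exact ⟨0, δ, le_rfl, hδ, by simp, by simp⟩
      · exact ⟨0, 0, le_rfl, le_rfl, by simpa using hδ, by simp⟩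
    · rintro _ ⟨s, r, hs, hr, hsr, rfl⟩ _ ⟨s', r', hs', hr', hsr', rfl⟩ a b ha hb hab
      refine ⟨a * s + b * s', a * r + b * r', by positivity, by positivity, ?_, ?_⟩
      · calc a * s + b * s' + (a * r + b * r') = a * (s + r) + b * (s' + r') := by ring
          _ ≤ a * δ + b * δ := by gcongr
          _ = δ := by rw [← add_mul, hab, one_mul]
      · obtain rfl : b = 1 - a := by linarith
        module
  exact this hu

lemma dist_sq2 (u v : E2) : dist u v ^ 2 = (u 0 - v 0) ^ 2 + (u 1 - v 1) ^ 2 := by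
  rw [EuclideanSpace.dist_eq, Real.sq_sqrt (by positivity)]
  simp [Fin.sum_univ_two, Real.dist_eq, sq_abs]

lemma seg_mem (z x : E2) (t : ℝ) (h0 : 0 < t) (h1 : t < 1) :
    z + t • (x - z) ∈ openSegment ℝ z x :=
  ⟨1 - t, t, by linarith, h0, by ring, by module⟩

/-- If the two open segments `zx` and `zy` are entirely of color `i`, then some triangle `pqz`
with `p` on `zx` and `q` on `zy` can be recolored with color `i`, keeping the coloring proper. -/
theorem stmt_8 (c : EuclideanSpace ℝ (Fin 2) → Fin 6)
    (hc : ∀ x y : EuclideanSpace ℝ (Fin 2), dist x y = 1 → c x ≠ c y)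
    (hreal : ∀ w : EuclideanSpace ℝ (Fin 2), w ∈ closure (interior (c ⁻¹' {c w})))
    (x y z : EuclideanSpace ℝ (Fin 2)) (hind : AffineIndependent ℝ ![x, y, z]) (i : Fin 6)
    (hzx : ∀ p ∈ openSegment ℝ z x, c p = i)
    (hzy : ∀ p ∈ openSegment ℝ z y, c p = i) :
    ∃ p ∈ openSegment ℝ z x, ∃ q ∈ openSegment ℝ z y,
      ∀ x' y' : EuclideanSpace ℝ (Fin 2), dist x' y' = 1 →
        (if x' ∈ interior (convexHull ℝ ({p, q, z} : Set (EuclideanSpace ℝ (Fin 2))))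
          then i else c x') ≠
        (if y' ∈ interior (convexHull ℝ ({p, q, z} : Set (EuclideanSpace ℝ (Fin 2))))
          then i else c y') := by
  obtain ⟨δ, hδ0, hδ1, hδx, hδy, hcore⟩ := core _ _ _ _ (det_ne x y z hind)
  refine ⟨z + δ • (x - z), seg_mem z x δ hδ0 (by linarith),
    z + δ • (y - z), seg_mem z y δ hδ0 (by linarith), ?_⟩
  set T := convexHull ℝ ({z + δ • (x - z), z + δ • (y - z), z} : Set (EuclideanSpace ℝ (Fin 2)))
    with hT
  -- the triangle is small
  have hsmall : T ⊆ Metric.ball z (1 / 4) := by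
    apply convexHull_min _ (convex_ball z (1 / 4))
    rintro v (rfl | rfl | rfl)
    · rw [Metric.mem_ball]
      have := dist_sq2 (z + δ • (x - z)) z
      simp at this
      simp
      nlinarith [norm_nonneg (δ • (x - z))]
    · rw [Metric.mem_ball]
      have := dist_sq2 (z + δ • (y - z)) z
      simp at this
      simp
      nlinarith [norm_nonneg (δ • (y - z))]
    · simp
  -- main claim
  have main : ∀ u w, u ∈ interior T → dist u w = 1 → c w ≠ i := by
    intro u w hu huw hw
    -- perturb
    have hopen : IsOpen (interior (c ⁻¹' {i}) ∩ (fun v => u + (v - w)) ⁻¹' interior T) :=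
      isOpen_interior.inter (isOpen_interior.preimage (by fun_prop))
    have hne : (interior (c ⁻¹' {i}) ∩ (fun v => u + (v - w)) ⁻¹' interior T).Nonempty := by
      have h1 := hreal w
      rw [hw] at h1
      have h2 := mem_closure_iff.mp h1 ((fun v => u + (v - w)) ⁻¹' interior T)
        (isOpen_interior.preimage (by fun_prop)) (by simpa using hu)
      rwa [Set.inter_comm]
    have hnot : ¬ (interior (c ⁻¹' {i}) ∩ (fun v => u + (v - w)) ⁻¹' interior T)
        ⊆ Metric.sphere z 1 := by
      intro hsub
      have h3 := interior_maximal hsub hopen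
      rw [interior_sphere z one_ne_zero] at h3
      exact hne.not_subset_empty h3
    obtain ⟨v, ⟨hv1, hv2⟩, hv3⟩ := Set.not_subset.mp hnot
    have hvm : v ∈ c ⁻¹' {i} := interior_subset hv1
    have hvi : c v = i := by simpa using hvm
    have hvT : u + (v - w) ∈ T := interior_subset hv2
    have hdist : dist (u + (v - w)) v = 1 := by
      rw [← huw, dist_eq_norm, dist_eq_norm]; congr 1; abel
    have hzv : dist z v ≠ 1 := by rwa [Metric.mem_sphere, dist_comm] at hv3
    have hnx : ∀ t : ℝ, 0 < t → t < 1 → dist (z + t • (x - z)) v ≠ 1 := fun t h0 h1 hd =>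
      hc _ _ hd ((hzx _ (seg_mem z x t h0 h1)).trans hvi.symm)
    have hny : ∀ t : ℝ, 0 < t → t < 1 → dist (z + t • (y - z)) v ≠ 1 := fun t h0 h1 hd =>
      hc _ _ hd ((hzy _ (seg_mem z y t h0 h1)).trans hvi.symm)
    rcases lt_or_gt_of_ne hzv with hlt | hgt
    · have hx := sign_aux (fun t => 1 - dist (z + t • (x - z)) v) (by fun_prop)
        (by simpa using hlt) (fun t h0 h1 hh => hnx t h0 h1 (by beta_reduce at hh; linarith)) δ hδ0 (by linarith)
      have hy := sign_aux (fun t => 1 - dist (z + t • (y - z)) v) (by fun_prop)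
        (by simpa using hlt) (fun t h0 h1 hh => hny t h0 h1 (by beta_reduce at hh; linarith)) δ hδ0 (by linarith)
      have hsub : T ⊆ Metric.ball v 1 := by
        apply convexHull_min _ (convex_ball v 1)
        rintro a (rfl | rfl | rfl)
        · rw [Metric.mem_ball]; linarith
        · rw [Metric.mem_ball]; linarith
        · exact hlt
      have := hsub hvT
      rw [Metric.mem_ball] at this
      linarith
    · have hx := sign_aux (fun t => dist (z + t • (x - z)) v - 1) (by fun_prop)
        (by simpa using hgt) (fun t h0 h1 hh => hnx t h0 h1 (by beta_reduce at hh; linarith))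
      have hy := sign_aux (fun t => dist (z + t • (y - z)) v - 1) (by fun_prop)
        (by simpa using hgt) (fun t h0 h1 hh => hny t h0 h1 (by beta_reduce at hh; linarith))
      obtain ⟨s, r, hs, hr, hsr, hueq⟩ := hull_mem x y z δ hδ0.le _ hvT
      rw [hueq] at hdist
      have d1 := dist_sq2 (z + s • (x - z) + r • (y - z)) v
      rw [hdist] at d1
      simp at d1
      have d2 := dist_sq2 z v
      obtain ⟨t, ht0, ht1, ht⟩ := hcore s r (v 0 - z 0) (v 1 - z 1) hs hr hsr
        (by linear_combination -d1) (by nlinarith)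
      rcases ht with ht | ht
      · have d3 := dist_sq2 (z + t • (x - z)) v
        have d4 := hx t ht0 ht1
        simp only [PiLp.add_apply, PiLp.smul_apply, PiLp.sub_apply, smul_eq_mul] at d3
        have d5 := (pow_le_one_iff_of_nonneg dist_nonneg two_ne_zero).mp
          (d3.trans_le (le_trans (le_of_eq (by ring)) ht))
        linarith
      · have d3 := dist_sq2 (z + t • (y - z)) v
        have d4 := hy t ht0 ht1
        simp only [PiLp.add_apply, PiLp.smul_apply, PiLp.sub_apply, smul_eq_mul] at d3
        have d5 := (pow_le_one_iff_of_nonneg dist_nonneg two_ne_zero).mp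
          (d3.trans_le (le_trans (le_of_eq (by ring)) ht))
        linarith
  intro a b hab
  by_cases ha : a ∈ interior T <;> by_cases hb : b ∈ interior T
  · have h1 := hsmall (interior_subset ha)
    have h2 := hsmall (interior_subset hb)
    rw [Metric.mem_ball] at h1 h2
    have := dist_triangle_right a b z
    linarith
  · rw [if_pos ha, if_neg hb]
    exact (main a b ha hab).symm
  · rw [if_neg ha, if_pos hb]
    exact main b a hb (by rwa [dist_comm])
  · rw [if_neg ha, if_neg hb]
    exact hc a b hab
end

section
/- Let c be a proper coloring of the plane with 6 colors. Let R₄, R₅, R₆ be nonempty open connected subsets of the plane on which c is constant with pairwise distinct values k₄, k₅, k₆ respectively, and let u ∈ closure R₄ ∩ closure R₅ ∩ closure R₆. Let 0 < δ < 1 and let x₄₅ ∈ closure R₄ ∩ closure R₅, x₄₆ ∈ closure R₄ ∩ closure R₆, x₅₆ ∈ closure R₅ ∩ closure R₆ be points each at distance δ from u. Let e be a unit vector and let α be the median (second largest) of the three angles between e and the vectors x₄₅ − u, x₄₆ − u, x₅₆ − u, where the angle between two nonzero vectors is the usual angle in [0, π] (the arccosine of the normalized inner product). Set h = δ * cos α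 + Real.sqrt (1 − δ² * (sin α)²). Then for every real r with min 1 h < r < max 1 h, the point u + r • e satisfies c (u + r • e) ∉ {k₄, k₅, k₆}. -/
theorem aux_region {E : Type*} [PseudoMetricSpace E] (c : E → Fin 6)
    (hc : ∀ x y : E, dist x y = 1 → c x ≠ c y) (R : Set E) (k : Fin 6)
    (hR : IsConnected R) (hk : ∀ x ∈ R, c x = k) (p a b : E)
    (ha : a ∈ closure R) (hb : b ∈ closure R) (h1 : dist p a < 1) (h2 : 1 < dist p b) :
    c p ≠ k := by
  have hcont : Continuous (fun y => dist p y) := by fun_prop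
  obtain ⟨a', ha1, ha2⟩ := mem_closure_iff.1 ha {y | dist p y < 1}
    (isOpen_lt hcont continuous_const) h1
  obtain ⟨b', hb1, hb2⟩ := mem_closure_iff.1 hb {y | 1 < dist p y}
    (isOpen_lt continuous_const hcont) h2
  obtain ⟨y, hy, hy1⟩ := hR.isPreconnected.intermediate_value ha2 hb2 hcont.continuousOn
    ⟨le_of_lt ha1, le_of_lt hb1⟩
  rw [← hk y hy]
  exact hc p y hy1

theorem aux_dist (u x e : EuclideanSpace ℝ (Fin 2)) (δ r : ℝ) (hd : dist x u = δ) (he : ‖e‖ = 1) :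
    dist (u + r • e) x ^ 2 =
      r ^ 2 - 2 * r * (δ * Real.cos (InnerProductGeometry.angle e (x - u))) + δ ^ 2 := by
  have h1 : u + r • e - x = r • e - (x - u) := by abel
  have h2 := InnerProductGeometry.cos_angle_mul_norm_mul_norm e (x - u)
  rw [dist_eq_norm] at hd
  rw [he, hd] at h2
  rw [dist_eq_norm, h1, norm_sub_sq_real, norm_smul, he, hd, inner_smul_left, ← h2]
  simp only [mul_one, Real.norm_eq_abs, sq_abs, conj_trivial]
  ring

theorem aux_median (a b c m : ℝ) (hm : m = a + b + c - max a (max b c) - min a (min b c)) :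
    ((a ≤ m ∧ b ≤ m) ∨ (a ≤ m ∧ c ≤ m) ∨ (b ≤ m ∧ c ≤ m)) ∧
    ((m ≤ a ∧ m ≤ b) ∨ (m ≤ a ∧ m ≤ c) ∨ (m ≤ b ∧ m ≤ c)) ∧ (m = a ∨ m = b ∨ m = c) := by
  grind

/-- On the ray from a trichromatic point `u` in direction `e`, the segment between radii
`1` and `h` avoids the three colors of the regions meeting at `u`, where `h` is determined by
the median of the angles between `e` and the directions to the boundary points `x₄₅, x₄₆, x₅₆`
at distance `δ` from `u`. -/
theorem stmt_9 (c : EuclideanSpace ℝ (Fin 2) → Fin 6)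
    (hc : ∀ x y : EuclideanSpace ℝ (Fin 2), dist x y = 1 → c x ≠ c y)
    (R₄ R₅ R₆ : Set (EuclideanSpace ℝ (Fin 2))) (k₄ k₅ k₆ : Fin 6)
    (hk45 : k₄ ≠ k₅) (hk46 : k₄ ≠ k₆) (hk56 : k₅ ≠ k₆)
    (hR₄o : IsOpen R₄) (hR₄c : IsConnected R₄) (hR₄k : ∀ x ∈ R₄, c x = k₄)
    (hR₅o : IsOpen R₅) (hR₅c : IsConnected R₅) (hR₅k : ∀ x ∈ R₅, c x = k₅)
    (hR₆o : IsOpen R₆) (hR₆c : IsConnected R₆) (hR₆k : ∀ x ∈ R₆, c x = k₆)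
    (u : EuclideanSpace ℝ (Fin 2))
    (hu : u ∈ closure R₄ ∩ closure R₅ ∩ closure R₆)
    (δ : ℝ) (hδ0 : 0 < δ) (hδ1 : δ < 1)
    (x₄₅ x₄₆ x₅₆ : EuclideanSpace ℝ (Fin 2))
    (h45 : x₄₅ ∈ closure R₄ ∩ closure R₅) (h46 : x₄₆ ∈ closure R₄ ∩ closure R₆)
    (h56 : x₅₆ ∈ closure R₅ ∩ closure R₆)
    (hd45 : dist x₄₅ u = δ) (hd46 : dist x₄₆ u = δ) (hd56 : dist x₅₆ u = δ)
    (e : EuclideanSpace ℝ (Fin 2)) (he : ‖e‖ = 1)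
    (α h : ℝ)
    -- `α` is the median (second largest) of the three angles, i.e. their sum minus the
    -- largest and the smallest
    (hα : α =
      InnerProductGeometry.angle e (x₄₅ - u) + InnerProductGeometry.angle e (x₄₆ - u) +
        InnerProductGeometry.angle e (x₅₆ - u) -
      max (InnerProductGeometry.angle e (x₄₅ - u))
        (max (InnerProductGeometry.angle e (x₄₆ - u)) (InnerProductGeometry.angle e (x₅₆ - u))) -
      min (InnerProductGeometry.angle e (x₄₅ - u))
        (min (InnerProductGeometry.angle e (x₄₆ - u)) (InnerProductGeometry.angle e (x₅₆ - u))))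
    (hh : h = δ * Real.cos α + Real.sqrt (1 - δ ^ 2 * Real.sin α ^ 2)) :
    ∀ r : ℝ, min 1 h < r → r < max 1 h → c (u + r • e) ∉ ({k₄, k₅, k₆} : Set (Fin 6)) := by
  intro r hr1 hr2
  obtain ⟨⟨hu4, hu5⟩, hu6⟩ := hu
  obtain ⟨m1, m2, m3⟩ := aux_median _ _ _ _ hα
  have hα0 : 0 ≤ α ∧ α ≤ Real.pi := by
    rcases m3 with h | h | h <;> rw [h] <;>
      exact ⟨InnerProductGeometry.angle_nonneg _ _, InnerProductGeometry.angle_le_pi _ _⟩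
  have hsc := Real.sin_sq_add_cos_sq α
  have hpos : 0 < 1 - δ ^ 2 * Real.sin α ^ 2 - (δ * Real.cos α) ^ 2 := by
    have : δ ^ 2 * Real.sin α ^ 2 + (δ * Real.cos α) ^ 2 = δ ^ 2 := by
      rw [mul_pow, ← mul_add, hsc, mul_one]
    nlinarith
  have hS2 := Real.sq_sqrt (show 0 ≤ 1 - δ ^ 2 * Real.sin α ^ 2 by
    nlinarith [sq_nonneg (δ * Real.cos α)])
  have hS0 := Real.sqrt_nonneg (1 - δ ^ 2 * Real.sin α ^ 2)
  set S := Real.sqrt (1 - δ ^ 2 * Real.sin α ^ 2) with hS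
  have hSabs : |δ * Real.cos α| < S := abs_lt_of_sq_lt_sq (by linarith) hS0
  obtain ⟨hSa, hSb⟩ := abs_lt.1 hSabs
  have hh0 : 0 < h := by linarith
  have hr0 : 0 < r := lt_trans (lt_min one_pos hh0) hr1
  have hprod : r ^ 2 - 2 * r * (δ * Real.cos α) + δ ^ 2 - 1 =
      (r - h) * (r - δ * Real.cos α + S) := by
    rw [hh]
    linear_combination hS2 - δ ^ 2 * hsc
  have hfac : 0 < r - δ * Real.cos α + S := by linarith
  have hdu : dist (u + r • e) u = r := by
    rw [dist_eq_norm, add_sub_cancel_left, norm_smul, he, mul_one, Real.norm_eq_abs,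
      abs_of_pos hr0]
  have hlt : ∀ x, dist x u = δ → InnerProductGeometry.angle e (x - u) ≤ α → r < h →
      dist (u + r • e) x < 1 := by
    intro x hx ha hrh
    have hd := aux_dist u x e δ r hx he
    have hcos := Real.cos_le_cos_of_nonneg_of_le_pi
      (InnerProductGeometry.angle_nonneg e (x - u)) hα0.2 ha
    have h3 := mul_le_mul_of_nonneg_left hcos (mul_pos hr0 hδ0).le
    have h4 := mul_pos (sub_pos.2 hrh) hfac
    nlinarith [dist_nonneg (x := u + r • e) (y := x)]
  have hgt : ∀ x, dist x u = δ → α ≤ InnerProductGeometry.angle e (x - u) → h < r →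
      1 < dist (u + r • e) x := by
    intro x hx ha hrh
    have hd := aux_dist u x e δ r hx he
    have hcos := Real.cos_le_cos_of_nonneg_of_le_pi hα0.1
      (InnerProductGeometry.angle_le_pi e (x - u)) ha
    have h3 := mul_le_mul_of_nonneg_left hcos (mul_pos hr0 hδ0).le
    have h4 := mul_pos (sub_pos.2 hrh) hfac
    nlinarith [dist_nonneg (x := u + r • e) (y := x)]
  have A4 := aux_region c hc R₄ k₄ hR₄c hR₄k (u + r • e)
  have A5 := aux_region c hc R₅ k₅ hR₅c hR₅k (u + r • e)
  have A6 := aux_region c hc R₆ k₆ hR₆c hR₆k (u + r • e)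
  have key : c (u + r • e) ≠ k₄ ∧ c (u + r • e) ≠ k₅ ∧ c (u + r • e) ≠ k₆ := by
    rcases le_total 1 h with h1h | h1h
    · rw [min_eq_left h1h] at hr1
      rw [max_eq_right h1h] at hr2
      have hu1 : 1 < dist (u + r • e) u := by rw [hdu]; exact hr1
      have B4 := fun x hx hx1 => A4 x u hx hu4 hx1 hu1
      have B5 := fun x hx hx1 => A5 x u hx hu5 hx1 hu1
      have B6 := fun x hx hx1 => A6 x u hx hu6 hx1 hu1
      rcases m1 with ⟨i, j⟩ | ⟨i, j⟩ | ⟨i, j⟩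
      · have i' := hlt _ hd45 i hr2
        have j' := hlt _ hd46 j hr2
        exact ⟨B4 _ h45.1 i', B5 _ h45.2 i', B6 _ h46.2 j'⟩
      · have i' := hlt _ hd45 i hr2
        have j' := hlt _ hd56 j hr2
        exact ⟨B4 _ h45.1 i', B5 _ h45.2 i', B6 _ h56.2 j'⟩
      · have i' := hlt _ hd46 i hr2
        have j' := hlt _ hd56 j hr2
        exact ⟨B4 _ h46.1 i', B5 _ h56.1 j', B6 _ h56.2 j'⟩
    · rw [min_eq_right h1h] at hr1
      rw [max_eq_left h1h] at hr2
      have hu1 : dist (u + r • e) u < 1 := by rw [hdu]; exact hr2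
      have B4 := fun x hx hx1 => A4 u x hu4 hx hu1 hx1
      have B5 := fun x hx hx1 => A5 u x hu5 hx hu1 hx1
      have B6 := fun x hx hx1 => A6 u x hu6 hx hu1 hx1
      rcases m2 with ⟨i, j⟩ | ⟨i, j⟩ | ⟨i, j⟩
      · have i' := hgt _ hd45 i hr1
        have j' := hgt _ hd46 j hr1
        exact ⟨B4 _ h45.1 i', B5 _ h45.2 i', B6 _ h46.2 j'⟩
      · have i' := hgt _ hd45 i hr1
        have j' := hgt _ hd56 j hr1
        exact ⟨B4 _ h45.1 i', B5 _ h45.2 i', B6 _ h56.2 j'⟩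
      · have i' := hgt _ hd46 i hr1
        have j' := hgt _ hd56 j hr1
        exact ⟨B4 _ h46.1 i', B5 _ h56.1 j', B6 _ h56.2 j'⟩
  simpa using key
end

section
/- Let f₁, f₂ : ℝ → ℝ be continuous on the interval [0,1], and suppose f₁ 0, f₁ 1, f₂ 0, f₂ 1 are all integers (each lies in the range of the coercion ℤ → ℝ). Suppose that for every t ∈ [0,1], the integer ⌊f₁ t + 1/2⌋ − ⌊f₂ t + 1/2⌋ is not divisible by 3. Then |(f₁ 1 − f₁ 0) − (f₂ 1 − f₂ 0)| ≤ 1. -/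
/-- Near `t`, the rounded value of a continuous function is the one at `t` or one less. -/
theorem floor_near (f : ℝ → ℝ) (S : Set ℝ) (hf : ContinuousOn f S) (t : ℝ) (ht : t ∈ S) :
    ∀ᶠ s in nhdsWithin t S, ⌊f t + 1/2⌋ - 1 ≤ ⌊f s + 1/2⌋ ∧ ⌊f s + 1/2⌋ ≤ ⌊f t + 1/2⌋ := by
  have hc : Filter.Tendsto f (nhdsWithin t S) (nhds (f t)) := hf t ht
  have h1 : (⌊f t + 1/2⌋ : ℝ) - 3/2 < f t := by
    have := Int.floor_le (f t + 1/2)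
    linarith
  have h2 : f t < (⌊f t + 1/2⌋ : ℝ) + 1/2 := by
    have := Int.lt_floor_add_one (f t + 1/2)
    linarith
  filter_upwards [hc.eventually (lt_mem_nhds h1), hc.eventually (gt_mem_nhds h2)] with s hs1 hs2
  constructor
  · rw [Int.le_floor]
    push_cast
    linarith
  · rw [← Int.lt_add_one_iff, Int.floor_lt]
    push_cast
    linarith

theorem floor_int_half (n : ℤ) : ⌊(n : ℝ) + 1/2⌋ = n := by
  rw [Int.floor_eq_iff]
  constructor <;> linarith

/-- Index lemma for complementary curves: if `f₁, f₂` are continuous color-preserving maps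
to the 3-colored line, with integer endpoint values, such that the colors
`⌊fᵢ t + 1/2⌋ mod 3` differ for all `t ∈ [0,1]`, then the indices differ by at most 1. -/
theorem stmt_10 (f₁ f₂ : ℝ → ℝ)
    (hf₁ : ContinuousOn f₁ (Set.Icc 0 1)) (hf₂ : ContinuousOn f₂ (Set.Icc 0 1))
    (hf₁0 : f₁ 0 ∈ Set.range ((↑) : ℤ → ℝ)) (hf₁1 : f₁ 1 ∈ Set.range ((↑) : ℤ → ℝ))
    (hf₂0 : f₂ 0 ∈ Set.range ((↑) : ℤ → ℝ)) (hf₂1 : f₂ 1 ∈ Set.range ((↑) : ℤ → ℝ))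
    (hdiff : ∀ t ∈ Set.Icc (0 : ℝ) 1, ¬ (3 ∣ (⌊f₁ t + 1/2⌋ - ⌊f₂ t + 1/2⌋))) :
    |(f₁ 1 - f₁ 0) - (f₂ 1 - f₂ 0)| ≤ 1 := by
  have hcont : ContinuousOn (fun t => (⌊f₁ t + 1/2⌋ - ⌊f₂ t + 1/2⌋) / 3) (Set.Icc (0 : ℝ) 1) := by
    intro t ht
    apply tendsto_nhds_of_eventually_eq
    filter_upwards [floor_near f₁ _ hf₁ t ht, floor_near f₂ _ hf₂ t ht, self_mem_nhdsWithin]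
      with s h1 h2 hs
    have := hdiff t ht
    have := hdiff s hs
    omega
  have hk := isPreconnected_Icc.constant hcont (x := 0) (y := 1) (by simp) (by simp)
  have d0 := hdiff 0 (by simp)
  have d1 := hdiff 1 (by simp)
  obtain ⟨a, ha⟩ := hf₁0
  obtain ⟨b, hb⟩ := hf₁1
  obtain ⟨c, hc⟩ := hf₂0
  obtain ⟨d, hd⟩ := hf₂1
  simp only [← ha, ← hb, ← hc, ← hd, floor_int_half] at hk d0 d1 ⊢
  have : |(b - a) - (d - c)| ≤ 1 := by
    rw [abs_le]
    omega
  exact_mod_cast this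
end

section
/- Let s ≥ 1 and let f : Fin s → (ℝ → ℝ) be a family of functions, each continuous on [0,1], with f i 0 and f i 1 integers for every i, and with every increment d i = f i 1 − f i 0 nonzero. Suppose that for every i with i + 1 < s and every t ∈ [0,1], the integer ⌊f i t + 1/2⌋ − ⌊f (i+1) t + 1/2⌋ is not divisible by 3. Then either d i > 0 for all i, or d i < 0 for all i. -/
/-- The difference of two complementary curves never crosses a multiple of three. -/
lemma no_cross (h : ℝ → ℝ) (hc : ContinuousOn h (Set.Icc 0 1)) (a b : ℤ)
    (ha : h 0 = a) (hb : h 1 = b)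
    (hn : ∀ t ∈ Set.Icc (0 : ℝ) 1, ∀ k : ℤ, h t ≠ 3 * k) : |b - a| < 2 := by
  by_contra hcon
  have hcon : 2 ≤ |b - a| := not_lt.mp hcon
  rcases le_abs.mp hcon with h2 | h2
  · have hk1 : a ≤ 3 * ((a + 2) / 3) := by omega
    have hk2 : 3 * ((a + 2) / 3) ≤ b := by omega
    obtain ⟨t, ht, hte⟩ := intermediate_value_Icc (zero_le_one) hc
      (show ((3 * ((a + 2) / 3) : ℤ) : ℝ) ∈ Set.Icc (h 0) (h 1) by
        rw [ha, hb]; exact ⟨by exact_mod_cast hk1, by exact_mod_cast hk2⟩)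
    exact hn t ht ((a + 2) / 3) (by rw [hte]; push_cast; rfl)
  · have hk1 : b ≤ 3 * ((b + 2) / 3) := by omega
    have hk2 : 3 * ((b + 2) / 3) ≤ a := by omega
    obtain ⟨t, ht, hte⟩ := intermediate_value_Icc' (zero_le_one) hc
      (show ((3 * ((b + 2) / 3) : ℤ) : ℝ) ∈ Set.Icc (h 1) (h 0) by
        rw [ha, hb]; exact ⟨by exact_mod_cast hk1, by exact_mod_cast hk2⟩)
    exact hn t ht ((b + 2) / 3) (by rw [hte]; push_cast; rfl)

/-- Indices of a chain of pairwise complementary curves are all positive or all negative. -/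
theorem stmt_11 (s : ℕ) (hs : 1 ≤ s) (f : Fin s → ℝ → ℝ)
    (hcont : ∀ i, ContinuousOn (f i) (Set.Icc 0 1))
    (hint0 : ∀ i, f i 0 ∈ Set.range ((↑) : ℤ → ℝ))
    (hint1 : ∀ i, f i 1 ∈ Set.range ((↑) : ℤ → ℝ))
    (hne : ∀ i, f i 1 - f i 0 ≠ 0)
    (hcompl : ∀ (i : Fin s) (h : (i : ℕ) + 1 < s), ∀ t ∈ Set.Icc (0 : ℝ) 1,
      ¬ (3 ∣ (⌊f i t + 1/2⌋ - ⌊f ⟨(i : ℕ) + 1, h⟩ t + 1/2⌋))) :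
    (∀ i, 0 < f i 1 - f i 0) ∨ (∀ i, f i 1 - f i 0 < 0) := by
  have step : ∀ (i : ℕ) (h : i + 1 < s),
      (0 < f ⟨i, by omega⟩ 1 - f ⟨i, by omega⟩ 0 ↔ 0 < f ⟨i + 1, h⟩ 1 - f ⟨i + 1, h⟩ 0) := by
    intro i h
    have hi : i < s := by omega
    obtain ⟨a0, ha0⟩ := hint0 ⟨i, hi⟩
    obtain ⟨a1, ha1⟩ := hint1 ⟨i, hi⟩
    obtain ⟨b0, hb0⟩ := hint0 ⟨i + 1, h⟩
    obtain ⟨b1, hb1⟩ := hint1 ⟨i + 1, h⟩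
    have hna := hne ⟨i, hi⟩
    have hnb := hne ⟨i + 1, h⟩
    have key := no_cross (fun t => f ⟨i, hi⟩ t - f ⟨i + 1, h⟩ t)
      ((hcont _).sub (hcont _)) (a0 - b0) (a1 - b1)
      (by simp [← ha0, ← hb0]) (by simp [← ha1, ← hb1])
      (by
        intro t ht k hk
        apply hcompl ⟨i, hi⟩ h t ht
        have e : f ⟨i, hi⟩ t + 1/2 = (f ⟨i + 1, h⟩ t + 1/2) + ((3 * k : ℤ) : ℝ) := by
          push_cast
          linarith
        rw [e, Int.floor_add_intCast]
        exact ⟨k, by ring⟩)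
    rw [← ha0, ← ha1] at hna ⊢
    rw [← hb0, ← hb1] at hnb ⊢
    norm_cast at hna hnb ⊢
    rw [abs_lt] at key
    omega
  have all : ∀ (i : ℕ) (h : i < s),
      (0 < f ⟨0, hs⟩ 1 - f ⟨0, hs⟩ 0 ↔ 0 < f ⟨i, h⟩ 1 - f ⟨i, h⟩ 0) := by
    intro i
    induction i with
    | zero => intro h; exact Iff.rfl
    | succ n ih => intro h; exact (ih (by omega)).trans (step n h)
  by_cases h0 : 0 < f ⟨0, hs⟩ 1 - f ⟨0, hs⟩ 0
  · left
    intro i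
    exact (all i i.2).mp h0
  · right
    intro i
    have h1 : ¬ 0 < f i 1 - f i 0 := fun h => h0 ((all i i.2).mpr h)
    exact lt_of_le_of_ne (not_lt.mp h1) (hne i)
end
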